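/- arXiv:2410.13578 — 4 statements merged into one kernel-verified Lean document; each statement's English description precedes it below -/
import Mathlib

section
/- Let q be a prime power, K = F_{q²}, and let C be a Hermitian LCD [n,k]_{q²} code. Let G be a generator matrix of C and H be a generator matrix of C^{⊥H}, and let M be the n×n matrix obtained by stacking G on top of H (M is invertible since C ⊕ C^{⊥H} = K^n). Then a matrix Q belongs to the stabilizer St_u(C) = {Q ∈ U_n(q²) : CQ = C} if and only if Q = M⁻¹ · diag(Q₁, Q₂) · M for some invertible k×k matrix Q₁ over K and invertible (n−k)×(n−k) matrix Q₂ over K satisfying Q₁(GḠᵀ)Q̄₁ᵀ = GḠᵀ and Q₂(HH̄ᵀ)Q̄₂ᵀ = HH̄ᵀ. -/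
open scoped BigOperators
open Matrix

noncomputable section

/-- The Hermitian inner product `⟨x,y⟩_H = ∑ i, x i * (y i)^q`, where the conjugation
`x ↦ x^q` is given by the ring homomorphism `σ`. -/
def hermInner {K : Type*} [Field K] {n : ℕ} (σ : K →+* K) (x y : Fin n → K) : K :=
  ∑ i, x i * σ (y i)

/-- The Hermitian dual `C^{⊥H} = {y | ⟨x,y⟩_H = 0 for all x ∈ C}` of a code `C ⊆ K^n`. -/
def hermDual {K : Type*} [Field K] {n : ℕ} (σ : K →+* K) (C : Submodule K (Fin n → K)) :
    Submodule K (Fin n → K) where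
  carrier := {y | ∀ x ∈ C, hermInner σ x y = 0}
  zero_mem' := by
    intro x hx
    simp [hermInner]
  add_mem' := by
    intro y z hy hz x hx
    have h1 := hy x hx
    have h2 := hz x hx
    simp only [hermInner, Pi.add_apply, map_add, mul_add, Finset.sum_add_distrib] at h1 h2 ⊢
    rw [h1, h2, add_zero]
  smul_mem' := by
    intro c y hy x hx
    have h := hy x hx
    simp only [hermInner, Pi.smul_apply, smul_eq_mul, _root_.map_mul] at h ⊢
    calc ∑ i, x i * (σ c * σ (y i)) = σ c * ∑ i, x i * σ (y i) := by
          rw [Finset.mul_sum]; exact Finset.sum_congr rfl fun i _ => by ring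
      _ = 0 := by rw [h, mul_zero]

theorem aux_rows {K : Type*} [Field K] {m n : ℕ} (A B : Matrix (Fin m) (Fin n) K)
    (h : ∀ i, B i ∈ Submodule.span K (Set.range fun i : Fin m => A i)) :
    ∃ P : Matrix (Fin m) (Fin m) K, B = P * A := by
  have h2 : ∀ i, ∃ c : Fin m → K, ∑ j, c j • A j = B i := fun i =>
    (Submodule.mem_span_range_iff_exists_fun K).1 (h i)
  choose c hc using h2
  refine ⟨Matrix.of c, ?_⟩
  ext i j
  rw [← hc i]
  simp [Matrix.mul_apply, Finset.sum_apply]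

theorem aux_inner {K : Type*} [Field K] {m l n : ℕ} (σ : K →+* K)
    (A : Matrix (Fin m) (Fin n) K) (B : Matrix (Fin l) (Fin n) K) (i : Fin m) (j : Fin l) :
    (A * (B.map σ)ᵀ) i j = hermInner σ (A i) (B j) := by
  simp [Matrix.mul_apply, hermInner]

theorem aux_unit {K : Type*} [Field K] {n : ℕ} (σ : K →+* K) (Q : Matrix (Fin n) (Fin n) K)
    (hQ : Q * (Q.map σ)ᵀ = 1) (x y : Fin n → K) :
    hermInner σ (x ᵥ* Q) (y ᵥ* Q) = hermInner σ x y := by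
  have h0 : ∀ u v : Fin n → K, hermInner σ u v = u ⬝ᵥ (fun i => σ (v i)) := fun u v => rfl
  rw [h0, h0]
  have h1 : (fun i => σ ((y ᵥ* Q) i)) = (Q.map σ)ᵀ *ᵥ (fun i => σ (y i)) := by
    ext i
    simp [Matrix.vecMul, Matrix.mulVec, dotProduct, mul_comm]
  rw [h1, ← Matrix.dotProduct_mulVec, Matrix.mulVec_mulVec, hQ, Matrix.one_mulVec]

theorem aux_conj {K : Type*} [Field K] {a b c : Type*} [Fintype b] (σ : K →+* K)
    (A : Matrix a b K) (B : Matrix b c K) :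
    ((A * B).map σ)ᵀ = (B.map σ)ᵀ * (A.map σ)ᵀ := by
  rw [Matrix.map_mul, Matrix.transpose_mul]

/-- Description of the stabilizer of a Hermitian LCD code in the unitary
group: `Q` stabilizes `C` iff `Q = M⁻¹ · diag(Q₁,Q₂) · M`, where `M` is the matrix obtained
by stacking a generator matrix `G` of `C` on top of a generator matrix `H` of `C^{⊥H}`, and
`Q₁, Q₂` are invertible matrices preserving the Gram matrices `G Ḡᵀ` and `H H̄ᵀ`. -/
theorem hermitianLCD_stabilizer
    (q : ℕ) (hq : IsPrimePow q)
    {K : Type*} [Field K] [Fintype K] (hK : Fintype.card K = q ^ 2)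
    (σ : K →+* K) (hσ : ∀ x : K, σ x = x ^ q)
    (n k : ℕ) (hkn : k ≤ n)
    (C : Submodule K (Fin n → K)) (hC : Module.finrank K C = k)
    (hLCD : C ⊓ hermDual σ C = ⊥)
    (G : Matrix (Fin k) (Fin n) K)
    (hGli : LinearIndependent K fun i : Fin k => G i)
    (hGsp : Submodule.span K (Set.range fun i : Fin k => G i) = C)
    (H : Matrix (Fin (n - k)) (Fin n) K)
    (hHli : LinearIndependent K fun i : Fin (n - k) => H i)
    (hHsp : Submodule.span K (Set.range fun i : Fin (n - k) => H i) = hermDual σ C)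
    (M : Matrix (Fin n) (Fin n) K)
    (hM : M = Matrix.of fun i j =>
      Matrix.fromRows G H
        ((finSumFinEquiv.trans (finCongr (by omega : k + (n - k) = n))).symm i) j)
    (hMunit : IsUnit M)
    (Q : Matrix (Fin n) (Fin n) K) :
    (IsUnit Q ∧ Q * (Q.map σ)ᵀ = 1 ∧ C.map (Matrix.vecMulLinear Q) = C) ↔
    ∃ (Q₁ : Matrix (Fin k) (Fin k) K) (Q₂ : Matrix (Fin (n - k)) (Fin (n - k)) K),
      IsUnit Q₁ ∧ IsUnit Q₂ ∧
      Q₁ * (G * (G.map σ)ᵀ) * (Q₁.map σ)ᵀ = G * (G.map σ)ᵀ ∧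
      Q₂ * (H * (H.map σ)ᵀ) * (Q₂.map σ)ᵀ = H * (H.map σ)ᵀ ∧
      Q = M⁻¹ *
          (Matrix.fromBlocks Q₁ 0 0 Q₂).submatrix
            ⇑(finSumFinEquiv.trans (finCongr (by omega : k + (n - k) = n))).symm
            ⇑(finSumFinEquiv.trans (finCongr (by omega : k + (n - k) = n))).symm *
          M := by
  classical
  generalize_proofs pf at hM ⊢
  revert hM
  generalize (finSumFinEquiv.trans (finCongr pf)) = e
  intro hM
  have hss : ∀ x, σ (σ x) = x := by
    intro x
    rw [hσ, hσ, ← pow_mul, ← sq, ← hK, FiniteField.pow_card]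
  have hGC : ∀ i, G i ∈ C := fun i => hGsp ▸ Submodule.subset_span ⟨i, rfl⟩
  have hHC : ∀ i, H i ∈ hermDual σ C := fun i => hHsp ▸ Submodule.subset_span ⟨i, rfl⟩
  have hGH : G * (H.map σ)ᵀ = 0 := by
    ext i j
    rw [aux_inner]
    exact hHC j _ (hGC i)
  have hHG : H * (G.map σ)ᵀ = 0 := by
    have h := congrArg (fun X => (X.map σ)ᵀ) hGH
    simp only [aux_conj] at h
    have h2 : (((H.map σ)ᵀ).map σ)ᵀ = H := by
      ext i j; simp [hss]
    rw [h2] at h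
    rw [h]
    ext i j; simp
  have hMA : M = (Matrix.fromRows G H).submatrix e.symm id := by
    rw [hM]; rfl
  have hMdet : IsUnit M.det := (Matrix.isUnit_iff_isUnit_det M).1 hMunit
  -- key equivalence
  have key : ∀ (Q₁ : Matrix (Fin k) (Fin k) K) (Q₂ : Matrix (Fin (n - k)) (Fin (n - k)) K),
      Q = M⁻¹ * (Matrix.fromBlocks Q₁ 0 0 Q₂).submatrix e.symm e.symm * M ↔
      (G * Q = Q₁ * G ∧ H * Q = Q₂ * H) := by
    intro Q₁ Q₂
    have h1 : (Matrix.fromBlocks Q₁ 0 0 Q₂).submatrix e.symm e.symm * M =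
        (Matrix.fromRows (Q₁ * G) (Q₂ * H)).submatrix e.symm id := by
      rw [hMA, Matrix.submatrix_mul_equiv, Matrix.fromBlocks_mul_fromRows]
      simp
    have h2 : M * Q = (Matrix.fromRows (G * Q) (H * Q)).submatrix e.symm id := by
      rw [hMA, ← Matrix.fromRows_mul]
      rfl
    rw [Matrix.mul_assoc, h1]
    constructor
    · intro h
      have h3 : M * Q = (Matrix.fromRows (Q₁ * G) (Q₂ * H)).submatrix e.symm id := by
        rw [h, Matrix.mul_nonsing_inv_cancel_left _ _ hMdet]
      rw [h2] at h3
      have h4 : Matrix.fromRows (G * Q) (H * Q) = Matrix.fromRows (Q₁ * G) (Q₂ * H) := by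
        ext i j
        have := congrFun (congrFun h3 (e i)) j
        simpa using this
      exact (Matrix.fromRows_ext_iff _ _ _ _).1 h4
    · rintro ⟨h3, h4⟩
      rw [← h3, ← h4, ← h2, Matrix.nonsing_inv_mul_cancel_left _ _ hMdet]
  have hGram : ∀ (R : Matrix (Fin n) (Fin n) K),
      M * R * (M.map σ)ᵀ = (Matrix.fromBlocks (G * R * (G.map σ)ᵀ) (G * R * (H.map σ)ᵀ)
        (H * R * (G.map σ)ᵀ) (H * R * (H.map σ)ᵀ)).submatrix e.symm e.symm := by
    intro R
    rw [hMA]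
    ext i j
    simp only [Matrix.submatrix_apply, Matrix.mul_apply, Matrix.transpose_apply, Matrix.map_apply,
      id]
    rcases e.symm i with a | a <;> rcases e.symm j with b | b <;>
      simp [Matrix.mul_apply]
  constructor
  · rintro ⟨hQ, hQQ, hCQ⟩
    have hG1 : ∀ i, (G * Q) i ∈ Submodule.span K (Set.range fun i => G i) := by
      intro i
      rw [hGsp, ← hCQ]
      exact ⟨G i, hGC i, rfl⟩
    have hH1 : ∀ i, (H * Q) i ∈ Submodule.span K (Set.range fun i => H i) := by
      intro i
      rw [hHsp]
      intro x hx
      rw [← hCQ] at hx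
      obtain ⟨y, hy, rfl⟩ := hx
      exact (aux_unit σ Q hQQ y (H i)).trans (hHC i y hy)
    obtain ⟨Q₁, h1⟩ := aux_rows _ _ hG1
    obtain ⟨Q₂, h2⟩ := aux_rows _ _ hH1
    have hE := (key Q₁ Q₂).2 ⟨h1, h2⟩
    have hdet : IsUnit (Q₁.det * Q₂.det) := by
      have h3 := (Matrix.isUnit_iff_isUnit_det Q).1 hQ
      rw [hE, Matrix.det_mul, Matrix.det_mul, Matrix.det_submatrix_equiv_self,
        Matrix.det_fromBlocks_zero₂₁] at h3
      exact isUnit_of_mul_isUnit_right (isUnit_of_mul_isUnit_left h3)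
    refine ⟨Q₁, Q₂, (Matrix.isUnit_iff_isUnit_det _).2 (isUnit_of_mul_isUnit_left hdet),
      (Matrix.isUnit_iff_isUnit_det _).2 (isUnit_of_mul_isUnit_right hdet), ?_, ?_, hE⟩
    · rw [← Matrix.mul_assoc, Matrix.mul_assoc, ← aux_conj, ← h1, aux_conj, Matrix.mul_assoc,
        ← Matrix.mul_assoc Q, hQQ, Matrix.one_mul]
    · rw [← Matrix.mul_assoc, Matrix.mul_assoc, ← aux_conj, ← h2, aux_conj, Matrix.mul_assoc,
        ← Matrix.mul_assoc Q, hQQ, Matrix.one_mul]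
  · rintro ⟨Q₁, Q₂, hu1, hu2, hq1, hq2, hE⟩
    obtain ⟨h1, h2⟩ := (key Q₁ Q₂).1 hE
    have hQQ : Q * (Q.map σ)ᵀ = 1 := by
      have e1 := hGram (Q * (Q.map σ)ᵀ)
      have e2 := hGram 1
      have c : ∀ {a b : ℕ} (A : Matrix (Fin a) (Fin n) K) (B : Matrix (Fin b) (Fin n) K),
          A * (Q * (Q.map σ)ᵀ) * (B.map σ)ᵀ = (A * Q) * ((B * Q).map σ)ᵀ := by
        intro a b A B
        rw [aux_conj]; simp only [Matrix.mul_assoc]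
      have d : ∀ {a b : ℕ} (A : Matrix (Fin a) (Fin n) K) (B : Matrix (Fin b) (Fin n) K)
          (X : Matrix (Fin a) (Fin a) K) (Y : Matrix (Fin b) (Fin b) K),
          (X * A) * ((Y * B).map σ)ᵀ = X * (A * (B.map σ)ᵀ) * (Y.map σ)ᵀ := by
        intro a b A B X Y
        rw [aux_conj]; simp only [Matrix.mul_assoc]
      rw [c G G, c G H, c H G, c H H, h1, h2, d, d, d, d, hq1, hq2, hGH, hHG] at e1
      simp only [Matrix.mul_one, hGH, hHG] at e2
      simp only [Matrix.mul_zero, Matrix.zero_mul] at e1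
      have e3 : M * (Q * (Q.map σ)ᵀ) * (M.map σ)ᵀ = M * 1 * (M.map σ)ᵀ := by
        rw [e1, Matrix.mul_one, e2]
      have hMc : IsUnit ((M.map σ)ᵀ) := by
        rw [Matrix.isUnit_transpose]
        exact hMunit.map σ.mapMatrix
      exact hMunit.mul_left_cancel (hMc.mul_right_cancel e3)
    have hQ : IsUnit Q := IsUnit.of_mul_eq_one _ hQQ
    refine ⟨hQ, hQQ, ?_⟩
    apply Submodule.eq_of_le_of_finrank_eq
    · rw [← hGsp, Submodule.map_span, Submodule.span_le]
      rintro _ ⟨_, ⟨i, rfl⟩, rfl⟩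
      have h3 : Matrix.vecMulLinear Q (G i) = (Q₁ * G) i := by
        rw [← h1]; rfl
      rw [h3]
      have h4 : (Q₁ * G) i = ∑ j, Q₁ i j • G j := by
        ext l; simp [Matrix.mul_apply, Finset.sum_apply]
      rw [h4]
      exact Submodule.sum_mem _ fun j _ => Submodule.smul_mem _ _ (Submodule.subset_span ⟨j, rfl⟩)
    · have hinj : Function.Injective (Matrix.vecMulLinear Q) :=
        Matrix.vecMul_injective_iff_isUnit.2 hQ
      exact (LinearEquiv.finrank_eq (Submodule.equivMapOfInjective _ hinj C)).symm
end
end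

section
/- Let q be a prime power and let 0 ≤ k ≤ n. The number of Hermitian LCD [n,k]_{q²} codes equals q^{k(n−k)} · ∏_{i=1}^{k} (q^{n−k+i} − (−1)^{n−k+i}) / (q^i − (−1)^i). -/
open scoped BigOperators
open Matrix

noncomputable section

section fieldlemmas
variable {K : Type*} [Field K] [Fintype K] {q : ℕ}

lemma aux_card_units (hK : Fintype.card K = q ^ 2) : Nat.card Kˣ = q ^ 2 - 1 := by
  rw [Nat.card_units, Nat.card_eq_fintype_card, hK]

lemma aux_card_root (d : ℕ) (hd : d ≠ 0) : 
    Nat.card {a : K // a ^ d = 1} = Nat.gcd (Nat.card Kˣ) d := by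
  rw [← IsCyclic.card_powMonoidHom_ker (G := Kˣ) d]
  symm
  refine Nat.card_congr ⟨fun u => ⟨(u.1 : K), ?_⟩, fun a => ⟨Units.ofPowEqOne a.1 d a.2 hd, ?_⟩, ?_, ?_⟩
  · have := u.2
    rw [MonoidHom.mem_ker, powMonoidHom_apply] at this
    rw [← Units.val_pow_eq_pow_val, this, Units.val_one]
  · rw [MonoidHom.mem_ker, powMonoidHom_apply]
    ext; simp
  · intro u; ext; simp
  · intro a; ext; simp

lemma aux_sq (hq : 2 ≤ q) : q ^ 2 - 1 = (q + 1) * (q - 1) := by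
  obtain ⟨r, rfl⟩ := Nat.exists_eq_add_of_le hq
  have : 2 + r - 1 = r + 1 := by omega
  rw [this]
  have : (2 + r) ^ 2 = (2 + r + 1) * (r + 1) + 1 := by ring
  omega

lemma aux_norm_card (hq : 2 ≤ q) (hK : Fintype.card K = q ^ 2) :
    Nat.card {a : K // a ^ (q + 1) = 1} = q + 1 := by
  rw [aux_card_root _ (by omega), aux_card_units hK, aux_sq hq, Nat.gcd_mul_right_left]

lemma aux_fix_card (hq : 2 ≤ q) (hK : Fintype.card K = q ^ 2) :
    Nat.card {a : K // a ^ q = a ∧ a ≠ 0} = q - 1 := by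
  have h := aux_card_root (K := K) (q - 1) (by omega)
  rw [aux_card_units hK, aux_sq hq, Nat.gcd_mul_left_left] at h
  rw [← h]
  apply Nat.card_congr
  apply Equiv.subtypeEquivRight
  intro a
  have hh : a ^ q = a ^ (q - 1) * a := by rw [← pow_succ]; congr 1; omega
  constructor
  · rintro ⟨h1, h2⟩
    rw [hh] at h1
    exact mul_right_cancel₀ h2 (by rw [h1, one_mul])
  · intro h1
    refine ⟨by rw [hh, h1, one_mul], ?_⟩
    rintro rfl
    rw [zero_pow (by omega)] at h1
    exact zero_ne_one h1

lemma aux_norm_surj (hq : 2 ≤ q) (hK : Fintype.card K = q ^ 2) (c : K) (h1 : c ^ q = c)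
    (h0 : c ≠ 0) : ∃ a : K, a ≠ 0 ∧ a ^ (q + 1) = c := by
  obtain ⟨g, hg⟩ := IsCyclic.exists_generator (α := Kˣ)
  obtain ⟨j, hj⟩ := (mem_powers_iff_mem_zpowers).2 (hg (Units.mk0 c h0))
  simp only at hj
  have hc : (Units.mk0 c h0) ^ (q - 1) = 1 := by
    ext
    simp only [Units.val_pow_eq_pow_val, Units.val_mk0, Units.val_one]
    apply mul_right_cancel₀ h0
    rw [← pow_succ, one_mul]
    convert h1 using 2; omega
  rw [← hj, ← pow_mul] at hc
  have := orderOf_dvd_of_pow_eq_one hc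
  rw [orderOf_eq_card_of_forall_mem_zpowers hg, aux_card_units hK, aux_sq hq] at this
  have := Nat.dvd_of_mul_dvd_mul_right (by omega) this
  obtain ⟨m, rfl⟩ := this
  refine ⟨((g ^ m : Kˣ) : K), Units.ne_zero _, ?_⟩
  have := congrArg (fun u : Kˣ => (u : K)) hj
  simp only [Units.val_mk0] at this
  rw [← this, ← Units.val_pow_eq_pow_val, ← pow_mul, mul_comm]

lemma aux_trace (hq : 2 ≤ q) (hK : Fintype.card K = q ^ 2) : ∃ b : K, b + b ^ q ≠ 0 := by
  by_contra! h
  have hp : (Polynomial.X ^ q + Polynomial.X : Polynomial K).natDegree = q := by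
    compute_degree!
    · split_ifs
      · omega
      · simp
    · omega
  have := Polynomial.card_le_degree_of_subset_roots (R := K) (p := Polynomial.X ^ q + Polynomial.X)
    (Z := Finset.univ) (by
      intro x _
      rw [Polynomial.mem_roots]
      · simp [add_comm, h x]
      · intro h0
        rw [h0] at hp
        simp at hp
        omega)
  rw [hp, Finset.card_univ, hK] at this
  nlinarith
end fieldlemmas
section form
variable {K : Type*} [Field K] {n : ℕ} (σ : K →+* K)

lemma hI_add_left (x y z : Fin n → K) :
    hermInner σ (x + y) z = hermInner σ x z + hermInner σ y z := by
  simp [hermInner, add_mul, Finset.sum_add_distrib]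

lemma hI_smul_left (c : K) (x z : Fin n → K) :
    hermInner σ (c • x) z = c * hermInner σ x z := by
  simp [hermInner, mul_assoc, Finset.mul_sum]

lemma hI_add_right (x y z : Fin n → K) :
    hermInner σ x (y + z) = hermInner σ x y + hermInner σ x z := by
  simp [hermInner, mul_add, Finset.sum_add_distrib]

lemma hI_smul_right (c : K) (x z : Fin n → K) :
    hermInner σ x (c • z) = σ c * hermInner σ x z := by
  simp [hermInner, Finset.mul_sum, mul_left_comm]

lemma hI_zero_right (x : Fin n → K) : hermInner σ x 0 = 0 := by simp [hermInner]
lemma hI_zero_left (x : Fin n → K) : hermInner σ 0 x = 0 := by simp [hermInner]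

lemma hI_conj (hσ2 : ∀ x, σ (σ x) = x) (x y : Fin n → K) :
    σ (hermInner σ x y) = hermInner σ y x := by
  simp [hermInner, hσ2, mul_comm]

/-- The linear functional `x ↦ ⟨x, v⟩`. -/
def hFun (v : Fin n → K) : (Fin n → K) →ₗ[K] K where
  toFun x := hermInner σ x v
  map_add' x y := hI_add_left σ x y v
  map_smul' c x := hI_smul_left σ c x v

/-- The orthogonal of a vector. -/
def hPerp (v : Fin n → K) : Submodule K (Fin n → K) := LinearMap.ker (hFun σ v)

lemma mem_hPerp {v x : Fin n → K} : x ∈ hPerp σ v ↔ hermInner σ x v = 0 := Iff.rfl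

/-- Nondegenerate subspaces. -/
def hND (W : Submodule K (Fin n → K)) : Prop :=
  ∀ x ∈ W, (∀ y ∈ W, hermInner σ y x = 0) → x = 0

lemma hND_iff (W : Submodule K (Fin n → K)) : hND σ W ↔ W ⊓ hermDual σ W = ⊥ := by
  rw [Submodule.eq_bot_iff]
  constructor
  · rintro h x ⟨h1, h2⟩
    exact h x h1 h2
  · intro h x h1 h2
    exact h x ⟨h1, h2⟩

lemma hND_top : hND σ (⊤ : Submodule K (Fin n → K)) := by
  intro x _ h
  ext i
  have := h (Pi.single i 1) trivial
  simp only [hermInner] at this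
  rw [Finset.sum_eq_single i] at this
  · simp at this
    simpa using this
  · intro b _ hb; simp [hb]
  · simp

lemma hND_bot : hND σ (⊥ : Submodule K (Fin n → K)) := by
  intro x hx _
  simpa using hx

variable {σ}

/-- Splitting off a unit vector. -/
def hSplit {W : Submodule K (Fin n → K)} {v : Fin n → K} (hv : v ∈ W)
    (h1 : hermInner σ v v = 1) : W ≃ₗ[K] K × (W ⊓ hPerp σ v : Submodule K (Fin n → K)) where
  toFun x := (hermInner σ x v, ⟨x - hermInner σ x v • v,
    ⟨W.sub_mem x.2 (W.smul_mem _ hv), by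
      have := (hFun σ v).map_sub x (hermInner σ x v • v)
      rw [SetLike.mem_coe, mem_hPerp]
      change hermInner σ _ _ = hermInner σ _ _ - hermInner σ _ _ at this
      rw [this, hI_smul_left, h1, mul_one, sub_self]⟩⟩)
  map_add' x y := by
    ext i
    · simp [hI_add_left]
    · simp [hI_add_left]; ring
  map_smul' c x := by
    ext i
    · simp [hI_smul_left]
    · simp [hI_smul_left]; ring
  invFun p := ⟨p.1 • v + p.2.1, W.add_mem (W.smul_mem _ hv) p.2.2.1⟩
  left_inv x := by
    ext i; simp
  right_inv p := by
    have h2 := (mem_hPerp σ).1 p.2.2.2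
    ext i
    · simp [hI_add_left, hI_smul_left, h1, h2]
    · simp [hI_add_left, hI_smul_left, h1, h2]

lemma hSplit_finrank {W : Submodule K (Fin n → K)} {v : Fin n → K} (hv : v ∈ W)
    (h1 : hermInner σ v v = 1) :
    Module.finrank K W = Module.finrank K (W ⊓ hPerp σ v : Submodule K (Fin n → K)) + 1 := by
  rw [(hSplit hv h1).finrank_eq, Module.finrank_prod, Module.finrank_self, add_comm]

lemma hND_inf (hσ2 : ∀ x, σ (σ x) = x) {W : Submodule K (Fin n → K)} {v : Fin n → K} (hv : v ∈ W)
    (h1 : hermInner σ v v = 1) (hW : hND σ W) : hND σ (W ⊓ hPerp σ v) := by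
  rintro x ⟨hx, hxv⟩ h
  apply hW x hx
  intro y hy
  have h2 := h _ ((hSplit hv h1 ⟨y, hy⟩).2).2
  have h3 : y = hermInner σ y v • v + ((hSplit hv h1 ⟨y, hy⟩).2 : Fin n → K) := by
    simp [hSplit]
  have h4 : hermInner σ v x = 0 := by
    rw [← hI_conj σ hσ2, (mem_hPerp σ).1 hxv, map_zero]
  rw [h3, hI_add_left, h2, hI_smul_left, h4, mul_zero, add_zero]

lemma hInf_sup {C : Submodule K (Fin n → K)} {v : Fin n → K} 
    (h1 : hermInner σ v v = 1) (hC : C ≤ hPerp σ v) : (K ∙ v ⊔ C) ⊓ hPerp σ v = C := by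
  apply le_antisymm
  · rintro x ⟨hx, hxv⟩
    obtain ⟨a, ha, c, hc, rfl⟩ := Submodule.mem_sup.1 hx
    obtain ⟨t, rfl⟩ := Submodule.mem_span_singleton.1 ha
    have := (mem_hPerp σ).1 hxv
    rw [hI_add_left, (mem_hPerp σ).1 (hC hc), hI_smul_left, h1, add_zero, mul_one] at this
    subst this
    simpa using hc
  · exact le_inf le_sup_right hC

lemma hSup_inf {C : Submodule K (Fin n → K)} {v : Fin n → K} (hv : v ∈ C)
    (h1 : hermInner σ v v = 1) : (K ∙ v ⊔ C ⊓ hPerp σ v) = C := by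
  apply le_antisymm
  · refine sup_le ?_ inf_le_left
    rwa [Submodule.span_singleton_le_iff_mem]
  · intro y hy
    have h3 : y = hermInner σ y v • v + ((hSplit hv h1 ⟨y, hy⟩).2 : Fin n → K) := by
      simp [hSplit]
    rw [h3]
    exact Submodule.add_mem_sup (Submodule.smul_mem _ _ (Submodule.mem_span_singleton_self v))
      ((hSplit hv h1 ⟨y, hy⟩).2).2

lemma hND_sup (hσ2 : ∀ x, σ (σ x) = x) {C : Submodule K (Fin n → K)} {v : Fin n → K} 
    (h1 : hermInner σ v v = 1) (hC : C ≤ hPerp σ v) 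
    (hN : hND σ C) : hND σ (K ∙ v ⊔ C) := by
  intro x hx h
  have hxv : hermInner σ x v = 0 := by
    rw [← hI_conj σ hσ2,
      h v (Submodule.mem_sup_left (Submodule.mem_span_singleton_self v)), map_zero]
  have hxC : x ∈ C := by
    rw [← hInf_sup h1 hC]
    exact ⟨hx, hxv⟩
  exact hN x hxC fun y hy => h y (Submodule.mem_sup_right hy)

end form
section counting
variable {K : Type*} [Field K] [Fintype K] {n q : ℕ} {σ : K →+* K}

lemma aux_invol (hK : Fintype.card K = q ^ 2) (hσ : ∀ x : K, σ x = x ^ q) (x : K) :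
    σ (σ x) = x := by
  rw [hσ, hσ, ← pow_mul, ← sq, ← hK, FiniteField.pow_card]

/-- Number of vectors of norm `c`. -/
def hT (σ : K →+* K) (W : Submodule K (Fin n → K)) (c : K) : ℕ :=
  Nat.card {w : Fin n → K // w ∈ W ∧ hermInner σ w w = c}

lemma hI_self_smul (hσ : ∀ x : K, σ x = x ^ q) (a : K) (w : Fin n → K) :
    hermInner σ (a • w) (a • w) = a ^ (q + 1) * hermInner σ w w := by
  rw [hI_smul_left, hI_smul_right, hσ]; ring

lemma hT_scale (hq : 2 ≤ q) (hK : Fintype.card K = q ^ 2) (hσ : ∀ x : K, σ x = x ^ q)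
    (W : Submodule K (Fin n → K)) (c : K) (hc : c ^ q = c) (h0 : c ≠ 0) :
    hT σ W c = hT σ W 1 := by
  obtain ⟨a, ha, rfl⟩ := aux_norm_surj hq hK c hc h0
  symm
  refine Nat.card_congr ⟨fun w => ⟨a • w.1, W.smul_mem _ w.2.1, ?_⟩,
    fun w => ⟨a⁻¹ • w.1, W.smul_mem _ w.2.1, ?_⟩, ?_, ?_⟩
  · rw [hI_self_smul hσ, w.2.2, mul_one]
  · rw [hI_self_smul hσ, w.2.2, ← mul_pow, inv_mul_cancel₀ ha, one_pow]
  · intro w; ext; simp [ha]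
  · intro w; ext; simp [ha]

lemma hT_zero (hK : Fintype.card K = q ^ 2) (hσ : ∀ x : K, σ x = x ^ q)
    (W : Submodule K (Fin n → K)) (c : K) (hc : c ^ q ≠ c) :
    hT σ W c = 0 := by
  have : IsEmpty {w : Fin n → K // w ∈ W ∧ hermInner σ w w = c} := by
    refine ⟨fun w => hc ?_⟩
    rw [← w.2.2, ← hσ, hI_conj σ (aux_invol hK hσ)]
  exact Nat.card_of_isEmpty

lemma hT_sum (hq : 2 ≤ q) (hK : Fintype.card K = q ^ 2) (hσ : ∀ x : K, σ x = x ^ q)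
    (W : Submodule K (Fin n → K)) :
    hT σ W 0 + (q - 1) * hT σ W 1 = (q ^ 2) ^ Module.finrank K W := by
  classical
  have e : (Σ c : K, {w : Fin n → K // w ∈ W ∧ hermInner σ w w = c}) ≃ W :=
    ⟨fun p => ⟨p.2.1, p.2.2.1⟩, fun w => ⟨hermInner σ w.1 w.1, w.1, w.2, rfl⟩,
      by rintro ⟨c, w, hw, rfl⟩; rfl, by intro w; rfl⟩
  have h1 := Nat.card_congr e
  rw [Nat.card_sigma] at h1
  have : Fintype W := Fintype.ofFinite W
  rw [Nat.card_eq_fintype_card, Module.card_eq_pow_finrank (K := K), hK] at h1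
  rw [← h1, ← aux_fix_card hq hK, Nat.card_eq_fintype_card, Fintype.card_subtype]
  have h2 : ∀ c : K, Nat.card {w : Fin n → K // w ∈ W ∧ hermInner σ w w = c} =
      (if c = 0 then hT σ W 0 else 0) + (if c ^ q = c ∧ c ≠ 0 then hT σ W 1 else 0) := by
    intro c
    change hT σ W c = _
    by_cases h0 : c = 0
    · simp [h0]
    · by_cases h3 : c ^ q = c
      · simp [h0, h3, hT_scale hq hK hσ W c h3 h0]
      · simp [h0, h3, hT_zero hK hσ W c h3]
  simp_rw [h2]
  rw [Finset.sum_add_distrib, ← Finset.sum_filter (p := fun c : K => c ^ q = c ∧ c ≠ 0)]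
  simp

lemma hT_rec (hq : 2 ≤ q) (hK : Fintype.card K = q ^ 2) (hσ : ∀ x : K, σ x = x ^ q)
    (W : Submodule K (Fin n → K)) {v : Fin n → K} (hv : v ∈ W)
    (hv1 : hermInner σ v v = 1) :
    hT σ W 1 + (q + 1) * hT σ (W ⊓ hPerp σ v) 1 =
      (q + 1) * hT σ (W ⊓ hPerp σ v) 0 + q ^ 2 * hT σ (W ⊓ hPerp σ v) 1 := by
  classical
  set W' := W ⊓ hPerp σ v with hW'
  have hinv := aux_invol hK hσ
  have key : ∀ (a : K) (w : Fin n → K), w ∈ W' →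
      hermInner σ (a • v + w) (a • v + w) = a ^ (q + 1) + hermInner σ w w := by
    intro a w hw
    have h2 : hermInner σ w v = 0 := (mem_hPerp σ).1 hw.2
    have h3 : hermInner σ v w = 0 := by rw [← hI_conj σ hinv, h2, map_zero]
    rw [hI_add_left, hI_add_right, hI_add_right, hI_self_smul hσ, hv1, hI_smul_left,
      hI_smul_right, h2, h3]
    ring
  have e : {w : Fin n → K // w ∈ W ∧ hermInner σ w w = 1} ≃
      (Σ a : K, {w : Fin n → K // w ∈ W' ∧ hermInner σ w w = 1 - a ^ (q + 1)}) := by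
    refine ⟨fun w => ⟨(hSplit hv hv1 ⟨w.1, w.2.1⟩).1, (hSplit hv hv1 ⟨w.1, w.2.1⟩).2.1,
      (hSplit hv hv1 ⟨w.1, w.2.1⟩).2.2, ?_⟩,
      fun p => ⟨((hSplit hv hv1).symm (p.1, ⟨p.2.1, p.2.2.1⟩)).1,
        ((hSplit hv hv1).symm (p.1, ⟨p.2.1, p.2.2.1⟩)).2, ?_⟩, ?_, ?_⟩
    · have h3 : w.1 = (hSplit hv hv1 ⟨w.1, w.2.1⟩).1 • v +
        ((hSplit hv hv1 ⟨w.1, w.2.1⟩).2 : Fin n → K) := by simp [hSplit]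
      have h4 := key (hSplit hv hv1 ⟨w.1, w.2.1⟩).1 _ (hSplit hv hv1 ⟨w.1, w.2.1⟩).2.2
      rw [← h3] at h4
      exact eq_sub_of_add_eq' (h4.symm.trans w.2.2)
    · have h4 := key p.1 p.2.1 p.2.2.1
      rw [p.2.2.2] at h4
      change hermInner σ (p.1 • v + p.2.1) (p.1 • v + p.2.1) = 1
      rw [h4]; ring
    · intro w
      ext1
      simp
    · rintro ⟨a, w, hw, h⟩
      have h5 := (hSplit hv hv1).apply_symm_apply (a, ⟨w, hw⟩)
      ext1
      · simp
      · simp only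
        simp
  have h1 := Nat.card_congr e
  rw [Nat.card_sigma] at h1
  change hT σ W 1 = ∑ a : K, hT σ W' (1 - a ^ (q + 1)) at h1
  have h2 : ∀ a : K, hT σ W' (1 - a ^ (q + 1)) + (if a ^ (q + 1) = 1 then hT σ W' 1 else 0) =
      (if a ^ (q + 1) = 1 then hT σ W' 0 else 0) + hT σ W' 1 := by
    intro a
    by_cases h0 : a ^ (q + 1) = 1
    · simp [h0]
    · simp only [h0, if_false, add_zero, zero_add]
      refine hT_scale hq hK hσ W' _ ?_ (sub_ne_zero.2 (Ne.symm h0))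
      rw [← hσ, map_sub, map_one, map_pow, hσ, pow_succ (a ^ q), ← pow_mul, ← sq, ← hK,
        FiniteField.pow_card, pow_succ', ]
  have h3 := Finset.sum_congr (rfl : (Finset.univ : Finset K) = _) fun a _ => h2 a
  rw [Finset.sum_add_distrib, Finset.sum_add_distrib, ← h1, ← Finset.sum_filter,
    ← Finset.sum_filter] at h3
  have h4 := aux_norm_card hq hK
  rw [Nat.card_eq_fintype_card, Fintype.card_subtype] at h4
  simpa [h4, hK] using h3

lemma exists_unit (hq : 2 ≤ q) (hK : Fintype.card K = q ^ 2) (hσ : ∀ x : K, σ x = x ^ q)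
    {W : Submodule K (Fin n → K)} (hN : hND σ W) (hW : W ≠ ⊥) :
    ∃ v ∈ W, hermInner σ v v = 1 := by
  have hinv := aux_invol hK hσ
  obtain ⟨x, hx, hxx⟩ : ∃ x ∈ W, hermInner σ x x ≠ 0 := by
    by_contra! h
    apply hW
    rw [Submodule.eq_bot_iff]
    intro x hx
    apply hN x hx
    intro y hy
    by_contra h0
    obtain ⟨b, hb⟩ := aux_trace hq hK
    apply hb
    have h1 := h _ (W.add_mem (W.smul_mem (b * (hermInner σ y x)⁻¹) hy) hx)
    rw [hI_add_left, hI_add_right, hI_add_right, h _ hx, h _ (W.smul_mem _ hy),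
      ← hI_conj σ hinv _ x, hI_smul_left, inv_mul_cancel_right₀ h0, hσ] at h1
    simpa using h1
  have h1 : (hermInner σ x x)⁻¹ ^ q = (hermInner σ x x)⁻¹ := by
    rw [inv_pow, ← hσ, hI_conj σ hinv]
  obtain ⟨a, ha, h2⟩ := aux_norm_surj hq hK _ h1 (inv_ne_zero hxx)
  exact ⟨a • x, W.smul_mem _ hx, by rw [hI_self_smul hσ, h2, inv_mul_cancel₀ hxx]⟩

lemma hT_formula (hq : 2 ≤ q) (hK : Fintype.card K = q ^ 2) (hσ : ∀ x : K, σ x = x ^ q)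
    (m : ℕ) : ∀ W : Submodule K (Fin n → K), hND σ W → Module.finrank K W = m →
    (hT σ W 1 : ℚ) * q = (q : ℚ) ^ m * ((q : ℚ) ^ m - (-1) ^ m) := by
  induction m with
  | zero =>
    intro W hN hm
    rw [Submodule.finrank_eq_zero] at hm
    subst hm
    have : IsEmpty {w : Fin n → K // w ∈ (⊥ : Submodule K (Fin n → K)) ∧ hermInner σ w w = 1} := by
      refine ⟨fun w => ?_⟩
      obtain ⟨w, h1, h2⟩ := w
      rw [Submodule.mem_bot] at h1
      rw [h1, hI_zero_left] at h2
      exact zero_ne_one h2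
    rw [hT, Nat.card_of_isEmpty]
    simp
  | succ m ih =>
    intro W hN hm
    have hW : W ≠ ⊥ := by
      rintro rfl
      simp at hm
    obtain ⟨v, hv, hv1⟩ := exists_unit hq hK hσ hN hW
    have h1 := hSplit_finrank hv hv1
    have h2 : Module.finrank K (W ⊓ hPerp σ v : Submodule K (Fin n → K)) = m := by omega
    have h3 := ih _ (hND_inf (aux_invol hK hσ) hv hv1 hN) h2
    have h4 := hT_sum hq hK hσ (W ⊓ hPerp σ v)
    have h5 := hT_rec hq hK hσ W hv hv1
    rw [h2] at h4
    generalize hT σ (W ⊓ hPerp σ v) 1 = s at *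
    generalize hT σ (W ⊓ hPerp σ v) 0 = z at *
    generalize hT σ W 1 = t at *
    have h4' : (z : ℚ) + (q - 1) * s = ((q : ℚ) ^ m) ^ 2 := by
      rw [← pow_mul, mul_comm m 2, pow_mul]
      have := congrArg (Nat.cast : ℕ → ℚ) h4
      push_cast [Nat.cast_sub (by omega : 1 ≤ q)] at this
      exact this
    have h5' : (t : ℚ) + (q + 1) * s = (q + 1) * z + q ^ 2 * s := by exact_mod_cast h5
    rw [pow_succ, pow_succ]
    linear_combination q * h5' + q * (q + 1) * h4' - q * h3

/-- Nondegenerate subspaces of `W` of dimension `k`. -/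
abbrev hSub (σ : K →+* K) (W : Submodule K (Fin n → K)) (k : ℕ) : Type _ :=
  {C : Submodule K (Fin n → K) // C ≤ W ∧ Module.finrank K C = k ∧ hND σ C}

lemma hSub_count (hq : 2 ≤ q) (hK : Fintype.card K = q ^ 2) (hσ : ∀ x : K, σ x = x ^ q)
    (k : ℕ) (W : Submodule K (Fin n → K)) (F : ℚ)
    (hF : ∀ v ∈ W, hermInner σ v v = 1 → (Nat.card (hSub σ (W ⊓ hPerp σ v) k) : ℚ) = F) :
    (Nat.card (hSub σ W (k + 1)) : ℚ) * ((q : ℚ) ^ (k + 1) * ((q : ℚ) ^ (k + 1) - (-1) ^ (k + 1))) =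
      hT σ W 1 * q * F := by
  classical
  have hinv := aux_invol hK hσ
  have e : (Σ C : hSub σ W (k + 1), {w : Fin n → K // w ∈ C.1 ∧ hermInner σ w w = 1}) ≃
    (Σ v : {w : Fin n → K // w ∈ W ∧ hermInner σ w w = 1}, hSub σ (W ⊓ hPerp σ v.1) k) := by
    refine ⟨fun p => ⟨⟨p.2.1, p.1.2.1 p.2.2.1, p.2.2.2⟩, p.1.1 ⊓ hPerp σ p.2.1,
        inf_le_inf_right _ p.1.2.1, ?_, hND_inf hinv p.2.2.1 p.2.2.2 p.1.2.2.2⟩,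
      fun p => ⟨⟨K ∙ p.1.1 ⊔ p.2.1, ?_, ?_,
        hND_sup hinv p.1.2.2 (p.2.2.1.trans inf_le_right) p.2.2.2.2⟩,
        p.1.1, Submodule.mem_sup_left (Submodule.mem_span_singleton_self _), p.1.2.2⟩, ?_, ?_⟩
    · have h1 := hSplit_finrank p.2.2.1 p.2.2.2
      have h2 := p.1.2.2.1
      omega
    · refine sup_le ?_ (p.2.2.1.trans inf_le_left)
      rw [Submodule.span_singleton_le_iff_mem]
      exact p.1.2.1
    · rw [hSplit_finrank (Submodule.mem_sup_left (Submodule.mem_span_singleton_self p.1.1)) p.1.2.2,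
        hInf_sup p.1.2.2 (p.2.2.1.trans inf_le_right), p.2.2.2.1]
    · rintro ⟨⟨C, hC⟩, w, hw, hw1⟩
      have := hSup_inf hw hw1
      ext1
      · simp only [this]
      · simp only
    · rintro ⟨⟨v, hv, hv1⟩, C, hC, hC2⟩
      have := hInf_sup hv1 (hC.trans inf_le_right)
      simp only [this]
  have h1 := congrArg (Nat.cast : ℕ → ℚ) (Nat.card_congr e)
  have i1 : Fintype (hSub σ W (k + 1)) := Fintype.ofFinite _
  have i2 : Fintype {w : Fin n → K // w ∈ W ∧ hermInner σ w w = 1} := Fintype.ofFinite _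
  rw [Nat.card_sigma, Nat.card_sigma, Nat.cast_sum, Nat.cast_sum,
    Finset.sum_congr rfl (fun (v : {w : Fin n → K // w ∈ W ∧ hermInner σ w w = 1}) _ => hF v.1 v.2.1 v.2.2)] at h1
  have h2 := congrArg (· * (q : ℚ)) h1
  simp only [Finset.sum_mul] at h2
  rw [Finset.sum_congr rfl (fun C _ => hT_formula hq hK hσ (k + 1) C.1 C.2.2.2 C.2.2.1)] at h2
  rw [Finset.sum_const, Finset.sum_const, Finset.card_univ, Finset.card_univ,
    ← Nat.card_eq_fintype_card, ← Nat.card_eq_fintype_card, nsmul_eq_mul, nsmul_eq_mul] at h2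
  rw [h2, hT]; ring

lemma aux_den (hq : 2 ≤ q) (i : ℕ) (hi : i ≠ 0) : (q : ℚ) ^ i - (-1) ^ i ≠ 0 := by
  have h1 : (1 : ℚ) < (q : ℚ) ^ i := one_lt_pow₀ (by exact_mod_cast (by omega : 1 < q)) hi
  rcases neg_one_pow_eq_or ℚ i with h | h <;> rw [h] <;> linarith

lemma hSub_formula (hq : 2 ≤ q) (hK : Fintype.card K = q ^ 2) (hσ : ∀ x : K, σ x = x ^ q)
    (k : ℕ) : ∀ (m : ℕ), k ≤ m → ∀ W : Submodule K (Fin n → K), hND σ W →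
    Module.finrank K W = m →
    (Nat.card (hSub σ W k) : ℚ) = (q : ℚ) ^ (k * (m - k)) *
        ∏ i ∈ Finset.Icc 1 k,
          ((q : ℚ) ^ (m - k + i) - (-1) ^ (m - k + i)) / ((q : ℚ) ^ i - (-1) ^ i) := by
  induction k with
  | zero =>
    intro m _ W hN hm
    have : Unique (hSub σ W 0) := by
      refine ⟨⟨⟨⊥, bot_le, by simp, hND_bot σ⟩⟩, ?_⟩
      rintro ⟨C, h1, h2, h3⟩
      rw [Submodule.finrank_eq_zero] at h2
      ext1; exact h2
    simp
  | succ k ih =>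
    intro m hkm W hN hm
    obtain ⟨d, rfl⟩ := Nat.exists_eq_add_of_le hkm
    have h1 := hSub_count hq hK hσ k W _ (fun v hv hv1 => ih (k + d) (by omega) _
      (hND_inf (aux_invol hK hσ) hv hv1 hN) (by have := hSplit_finrank hv hv1; omega))
    rw [hT_formula hq hK hσ _ W hN hm] at h1
    rw [Finset.prod_Icc_succ_top (by omega)]
    have e1 : k + 1 + d - (k + 1) = d := by omega
    have e2 : k + d - k = d := by omega
    rw [e2] at h1
    rw [e1]
    have hd := aux_den hq (k + 1) (by omega)
    have hq0 : (q : ℚ) ^ (k + 1) ≠ 0 := by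
      have : (q : ℚ) ≠ 0 := by exact_mod_cast (by omega : q ≠ 0)
      positivity
    apply mul_right_cancel₀ (mul_ne_zero hq0 hd)
    rw [h1, show d + (k + 1) = k + 1 + d by omega]
    generalize ∏ i ∈ Finset.Icc 1 k, ((q : ℚ) ^ (d + i) - (-1) ^ (d + i)) / ((q : ℚ) ^ i - (-1) ^ i) = P
    generalize (q : ℚ) ^ (k + 1 + d) - (-1) ^ (k + 1 + d) = A
    generalize (q : ℚ) ^ (k + 1) - (-1) ^ (k + 1) = B at *
    field_simp
    ring
end counting

/-- The number of Hermitian LCD `[n,k]_{q²}` codes equals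
`q^{k(n-k)} · ∏_{i=1}^{k} (q^{n-k+i} - (-1)^{n-k+i}) / (q^i - (-1)^i)`. -/
theorem card_hermitianLCD
    (q : ℕ) (hq : IsPrimePow q)
    {K : Type*} [Field K] [Fintype K] (hK : Fintype.card K = q ^ 2)
    (σ : K →+* K) (hσ : ∀ x : K, σ x = x ^ q)
    (n k : ℕ) (hkn : k ≤ n) :
    (Nat.card {C : Submodule K (Fin n → K) //
        Module.finrank K C = k ∧ C ⊓ hermDual σ C = ⊥} : ℚ) =
      (q : ℚ) ^ (k * (n - k)) *
        ∏ i ∈ Finset.Icc 1 k,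
          ((q : ℚ) ^ (n - k + i) - (-1) ^ (n - k + i)) / ((q : ℚ) ^ i - (-1) ^ i) := by
  have hq2 : 2 ≤ q := hq.two_le
  rw [← hSub_formula hq2 hK hσ k n hkn (⊤ : Submodule K (Fin n → K)) (hND_top σ) (by simp)]
  congr 1
  apply Nat.card_congr
  apply Equiv.subtypeEquivRight
  intro C
  simp [hND_iff]
end
end

section
/- Let q be a prime power, and let n, k, ℓ be positive integers with ℓ ≤ k ≤ n − ℓ; set k₀ = k − ℓ. Then the number |HHull[n,k]^ℓ_{q²}| of linear [n,k]_{q²} codes with ℓ-dimensional Hermitian hull equals (∏_{i=1}^{ℓ} A_{n,k₀,i}) · q^{k₀(n−k₀)} · ∏_{i=1}^{k₀} (q^{n−k₀+i} − (−1)^{n−k₀+i})/(q^i − (−1)^i) if n − k₀ is odd, and equals (∏_{i=1}^{ℓ} B_{n,k₀,i}) · q^{k₀(n−k₀)} · ∏_{i=1}^{k₀} (q^{n−k₀+i} − (−1)^{n−k₀+i})/(q^i − (−1)^i) if n − k₀ is even, where A_{n,k₀,i} = (q^{n−k₀−2i+2} + 1)(q^{n−k₀−2i+1} − 1) / (q^{2k₀}(q^{2i}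 − 1)) and B_{n,k₀,i} = (q^{n−k₀−2i+2} − 1)(q^{n−k₀−2i+1} + 1) / (q^{2k₀}(q^{2i} − 1)). -/
open scoped BigOperators
open Matrix

noncomputable section

section HermAux

theorem hh_norm_fiber {K : Type*} [Field K] [Fintype K] [DecidableEq K] (q : ℕ) (hq : 2 ≤ q)
    (hK : Fintype.card K = q ^ 2) (a : K) (ha : a ≠ 0) (haq : a ^ q = a) :
    (Finset.univ.filter (fun c : K => c * c ^ q = a)).card = q + 1 := by
  have hcard : Nat.card Kˣ = (q + 1) * (q - 1) := by
    rw [Nat.card_units, Nat.card_eq_fintype_card, hK, ← Nat.sq_sub_sq]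
  obtain ⟨g, hg⟩ := IsCyclic.exists_generator (α := Kˣ)
  have hog : orderOf g = (q + 1) * (q - 1) := by
    rw [orderOf_eq_card_of_forall_mem_zpowers hg, hcard]
  have hb : ∃ b : Kˣ, b ^ (q + 1) = Units.mk0 a ha := by
    obtain ⟨m, hm⟩ := (mem_powers_iff_mem_zpowers.mpr (hg (Units.mk0 a ha)))
    have h1 : (Units.mk0 a ha) ^ (q - 1) = 1 := by
      ext
      have : a * a ^ (q - 1) = a * 1 := by
        rw [← pow_succ', mul_one, Nat.sub_add_cancel (by omega), haq]
      simpa using mul_left_cancel₀ ha this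
    simp only at hm
    rw [← hm, ← pow_mul] at h1
    have h2 := orderOf_dvd_of_pow_eq_one h1
    rw [hog] at h2
    obtain ⟨t, rfl⟩ := Nat.dvd_of_mul_dvd_mul_right (by omega) h2
    exact ⟨g ^ t, by rw [← hm, ← pow_mul, mul_comm]⟩
  obtain ⟨b, hb⟩ := hb
  have hb' : (b : K) ^ (q + 1) = a := by
    have := congrArg Units.val hb
    simpa using this
  have hker := IsCyclic.card_powMonoidHom_ker (G := Kˣ) (q + 1)
  rw [hcard, Nat.gcd_eq_right (Dvd.intro _ rfl)] at hker
  classical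
  rw [← hker, Nat.card_eq_fintype_card, ← Finset.card_univ]
  symm
  refine Finset.card_bij (fun u _ => ((b * u.1 : Kˣ) : K)) ?_ ?_ ?_
  · rintro ⟨u, hu⟩ -
    have hu' : u ^ (q + 1) = 1 := hu
    have hu2 : (u : K) ^ (q + 1) = 1 := by
      have := congrArg Units.val hu'
      simpa using this
    simp only [Finset.mem_filter, Finset.mem_univ, true_and, Units.val_mul]
    rw [← pow_succ', mul_pow, hb', hu2, mul_one]
  · rintro ⟨u, hu⟩ - ⟨v, hv⟩ - huv
    have := Units.ext huv
    simpa using this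
  · intro c hc
    simp only [Finset.mem_filter, Finset.mem_univ, true_and] at hc
    have hc0 : c ≠ 0 := by
      rintro rfl
      exact ha (by rw [← hc, zero_mul])
    have hcu : (Units.mk0 c hc0) ^ (q + 1) = Units.mk0 a ha := by
      ext
      simpa [pow_succ'] using hc
    refine ⟨⟨b⁻¹ * Units.mk0 c hc0, ?_⟩, Finset.mem_univ _, by simp⟩
    change (b⁻¹ * Units.mk0 c hc0) ^ (q + 1) = 1
    rw [mul_pow, inv_pow, hb, hcu, inv_mul_cancel]

variable {K V : Type*} [Field K] [AddCommGroup V] [Module K V]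

structure HHerm (σ : K →+* K) (h : V → V → K) : Prop where
  add_left : ∀ x y z, h (x + y) z = h x z + h y z
  smul_left : ∀ (c : K) x z, h (c • x) z = c * h x z
  herm : ∀ x y, σ (h x y) = h y x

namespace HHerm

variable {σ : K →+* K} {h : V → V → K} (H : HHerm σ h)

theorem add_right (H : HHerm σ h) (x y z) : h x (y + z) = h x y + h x z := by
  rw [← H.herm, H.add_left, map_add, H.herm, H.herm]

theorem smul_right (H : HHerm σ h) (c : K) (x z) : h x (c • z) = σ c * h x z := by
  rw [← H.herm, H.smul_left, _root_.map_mul, H.herm]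

theorem zero_left (H : HHerm σ h) (z) : h 0 z = 0 := by
  have := H.smul_left 0 0 z
  simpa using this

theorem zero_right (H : HHerm σ h) (z) : h z 0 = 0 := by
  have := H.smul_right 0 z 0
  simpa using this

theorem symm_zero (H : HHerm σ h) {x y} (hxy : h x y = 0) : h y x = 0 := by
  rw [← H.herm, hxy, map_zero]

/-- orthogonal of a vector -/
def perp (H : HHerm σ h) (x : V) : Submodule K V where
  carrier := {y | h y x = 0}
  zero_mem' := H.zero_left x
  add_mem' := by
    intro a b ha hb
    simp only [Set.mem_ofPred_eq] at *
    rw [H.add_left, ha, hb, add_zero]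
  smul_mem' := by
    intro c a ha
    simp only [Set.mem_ofPred_eq] at *
    rw [H.smul_left, ha, mul_zero]

theorem mem_perp (H : HHerm σ h) {x y : V} : y ∈ H.perp x ↔ h y x = 0 := Iff.rfl

/-- radical of a subspace -/
def rad (H : HHerm σ h) (S : Submodule K V) : Submodule K V where
  carrier := {y | y ∈ S ∧ ∀ x ∈ S, h y x = 0}
  zero_mem' := ⟨S.zero_mem, fun x _ => H.zero_left x⟩
  add_mem' := by
    rintro a b ⟨ha, ha'⟩ ⟨hb, hb'⟩
    exact ⟨S.add_mem ha hb, fun x hx => by rw [H.add_left, ha' x hx, hb' x hx, add_zero]⟩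
  smul_mem' := by
    rintro c a ⟨ha, ha'⟩
    exact ⟨S.smul_mem c ha, fun x hx => by rw [H.smul_left, ha' x hx, mul_zero]⟩

theorem mem_rad (H : HHerm σ h) {S : Submodule K V} {y : V} :
    y ∈ H.rad S ↔ y ∈ S ∧ ∀ x ∈ S, h y x = 0 := Iff.rfl

theorem rad_le (H : HHerm σ h) (S : Submodule K V) : H.rad S ≤ S := fun _ hx => hx.1

/-- decomposition -/
theorem decomp (H : HHerm σ h) {S : Submodule K V} {x y : V} (hy : y ∈ S)
    (hyx : h y x ≠ 0) {s : V} (hs : s ∈ S) :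
    s - (h s x / h y x) • y ∈ S ⊓ H.perp x := by
  refine ⟨S.sub_mem hs (S.smul_mem _ hy), ?_⟩
  rw [SetLike.mem_coe, mem_perp, sub_eq_add_neg, ← neg_smul, H.add_left, H.smul_left]
  field_simp
  ring

theorem sup_eq (H : HHerm σ h) {S : Submodule K V} {x y : V} (hy : y ∈ S) (hyx : h y x ≠ 0) :
    (S ⊓ H.perp x) ⊔ Submodule.span K {y} = S := by
  apply le_antisymm
  · rw [sup_le_iff, Submodule.span_singleton_le_iff_mem]
    exact ⟨inf_le_left, hy⟩
  · intro s hs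
    rw [Submodule.mem_sup]
    exact ⟨_, H.decomp hy hyx hs, _, Submodule.mem_span_singleton.2 ⟨_, rfl⟩, sub_add_cancel _ _⟩

end HHerm

theorem hh_finrank_sup [Module.Finite K V] (D : Submodule K V) (y : V) (hy : y ∉ D) :
    Module.finrank K ↥(D ⊔ Submodule.span K {y}) = Module.finrank K D + 1 := by
  have h1 := Submodule.finrank_sup_add_finrank_inf_eq D (Submodule.span K {y})
  have h0 : y ≠ 0 := by rintro rfl; exact hy D.zero_mem
  rw [finrank_span_singleton h0] at h1
  have h2 : D ⊓ Submodule.span K {y} = ⊥ := by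
    rw [← disjoint_iff, Submodule.disjoint_span_singleton' h0]
    exact hy
  rw [h2, finrank_bot] at h1
  omega

namespace HHerm
variable {σ : K →+* K} {h : V → V → K}

theorem finrank_perp [Module.Finite K V] (H : HHerm σ h) {S : Submodule K V} {x y : V}
    (hy : y ∈ S) (hyx : h y x ≠ 0) :
    Module.finrank K ↥(S ⊓ H.perp x) + 1 = Module.finrank K S := by
  rw [← hh_finrank_sup (S ⊓ H.perp x) y (fun hh => hyx hh.2), H.sup_eq hy hyx]

theorem rad_perp_anis (H : HHerm σ h) {S : Submodule K V} {x : V}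
    (hx : x ∈ S) (hxx : h x x ≠ 0) : H.rad (S ⊓ H.perp x) = H.rad S := by
  ext z
  constructor
  · rintro ⟨⟨hz, hz'⟩, hzz⟩
    refine ⟨hz, fun s hs => ?_⟩
    have h1 := hzz _ (H.decomp hx hxx hs)
    have h2 : s = (s - (h s x / h x x) • x) + (h s x / h x x) • x := by abel
    rw [h2, H.add_right, h1, H.smul_right, H.mem_perp.1 hz']
    ring
  · rintro ⟨hz, hzz⟩
    exact ⟨⟨hz, hzz x hx⟩, fun s hs => hzz s hs.1⟩

theorem rad_perp_iso (H : HHerm σ h) {S : Submodule K V} {x : V}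
    (hx : x ∈ S) (hxx : h x x = 0) (hxr : x ∉ H.rad S) :
    H.rad (S ⊓ H.perp x) = H.rad S ⊔ Submodule.span K {x} := by
  have hy : ∃ y ∈ S, h x y ≠ 0 := by
    by_contra! hc
    exact hxr ⟨hx, hc⟩
  obtain ⟨y, hy, hxy⟩ := hy
  have hyx : h y x ≠ 0 := fun h0 => hxy (H.symm_zero h0)
  apply le_antisymm
  · rintro z ⟨⟨hz, hz'⟩, hzz⟩
    rw [Submodule.mem_sup]
    refine ⟨z - (h z y / h x y) • x, ⟨S.sub_mem hz (S.smul_mem _ hx), fun s hs => ?_⟩, _,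
      Submodule.mem_span_singleton.2 ⟨_, rfl⟩, sub_add_cancel _ _⟩
    have h1 := H.decomp hy hyx hs
    have h2 : s = (s - (h s x / h y x) • y) + (h s x / h y x) • y := by abel
    have h3 := hzz _ h1
    have h4 := H.symm_zero (H.mem_perp.1 h1.2)
    rw [h2, H.add_right, H.smul_right, sub_eq_add_neg, ← neg_smul, H.add_left, H.add_left, h3,
      H.smul_left, h4, H.smul_left]
    field_simp
    ring
  · rw [sup_le_iff, Submodule.span_singleton_le_iff_mem]
    exact ⟨fun z hz => ⟨⟨hz.1, hz.2 x hx⟩, fun s hs => hz.2 s hs.1⟩,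
      ⟨hx, hxx⟩, fun s hs => H.symm_zero hs.2⟩

end HHerm

namespace HHerm
variable {σ : K →+* K} {h : V → V → K}

open Classical in
/-- isotropic vectors of `S` -/
def iso [Fintype V] (h : V → V → K) (S : Submodule K V) : Finset V :=
  Finset.univ.filter (fun x => x ∈ S ∧ h x x = 0)

open Classical in
/-- anisotropic vectors of `S` -/
def anis [Fintype V] (h : V → V → K) (S : Submodule K V) : Finset V :=
  Finset.univ.filter (fun x => x ∈ S ∧ h x x ≠ 0)

theorem mem_iso [Fintype V] {S : Submodule K V} {x : V} :
    x ∈ iso h S ↔ x ∈ S ∧ h x x = 0 := by simp [iso]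

theorem mem_anis [Fintype V] {S : Submodule K V} {x : V} :
    x ∈ anis h S ↔ x ∈ S ∧ h x x ≠ 0 := by simp [anis]

open Classical in
theorem card_sub [Fintype K] [Fintype V] {q : ℕ} (hK : Fintype.card K = q ^ 2)
    (S : Submodule K V) : (Finset.univ.filter (fun x => x ∈ S)).card
      = q ^ (2 * Module.finrank K S) := by
  rw [pow_mul, ← hK, ← Module.card_eq_pow_finrank (K := K) (V := S), Fintype.card_subtype]

theorem iso_add_anis [Fintype K] [Fintype V] {q : ℕ} (hK : Fintype.card K = q ^ 2)
    (h : V → V → K) (S : Submodule K V) :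
    (iso h S).card + (anis h S).card = q ^ (2 * Module.finrank K S) := by
  classical
  rw [← card_sub hK S, ← Finset.card_filter_add_card_filter_not (fun x => h x x = 0)
    (s := Finset.univ.filter (fun x => x ∈ S)), Finset.filter_filter, Finset.filter_filter]
  rfl

theorem norm_expand (H : HHerm σ h) {x y : V} (hyx : h y x = 0) (c : K) :
    h (y + c • x) (y + c • x) = h y y + (c * σ c) * h x x := by
  rw [H.add_left, H.add_right, H.add_right, H.smul_left, H.smul_left, H.smul_right, H.smul_right,
    hyx, H.symm_zero hyx]
  ring

theorem iso_rec [Fintype K] [Fintype V] {q : ℕ} (hq : 2 ≤ q) (hK : Fintype.card K = q ^ 2)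
    (hσ : ∀ x : K, σ x = x ^ q) (H : HHerm σ h) {S : Submodule K V} {x : V}
    (hx : x ∈ S) (hxx : h x x ≠ 0) :
    (iso h S).card = (iso h (S ⊓ H.perp x)).card + (q + 1) * (anis h (S ⊓ H.perp x)).card := by
  classical
  set S' := S ⊓ H.perp x with hS'
  have hmaps : ∀ s ∈ iso h S, s - (h s x / h x x) • x ∈ iso h S' ∪ anis h S' := by
    intro s hs
    have := H.decomp hx hxx (mem_iso.1 hs).1
    rw [Finset.mem_union, mem_iso, mem_anis]
    by_cases h0 : h (s - (h s x / h x x) • x) (s - (h s x / h x x) • x) = 0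
    · exact Or.inl ⟨this, h0⟩
    · exact Or.inr ⟨this, h0⟩
  have hdisj : Disjoint (iso h S') (anis h S') := by
    rw [Finset.disjoint_left]
    intro a ha hb
    exact (mem_anis.1 hb).2 (mem_iso.1 ha).2
  have hfib : ∀ y ∈ S', ((iso h S).filter (fun s => s - (h s x / h x x) • x = y)).card =
      (Finset.univ.filter (fun c : K => c * c ^ q = - h y y / h x x)).card := by
    intro y hy
    symm
    have hyx : h y x = 0 := hy.2
    have hx0 : x ≠ 0 := by
      rintro rfl
      exact hxx (H.zero_left _)
    refine Finset.card_bij (fun c _ => y + c • x) ?_ ?_ ?_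
    · intro c hc
      simp only [Finset.mem_filter, Finset.mem_univ, true_and] at hc
      rw [Finset.mem_filter, mem_iso, H.norm_expand hyx, hσ, hc]
      refine ⟨⟨S.add_mem hy.1 (S.smul_mem _ hx), by field_simp; ring⟩, ?_⟩
      rw [H.add_left, hyx, H.smul_left, zero_add, mul_div_cancel_right₀ _ hxx,
        add_sub_cancel_right]
    · intro c _ d _ hcd
      exact smul_left_injective K hx0 (add_left_cancel hcd)
    · intro s hs
      rw [Finset.mem_filter, mem_iso] at hs
      obtain ⟨⟨hs, hss⟩, hsy⟩ := hs
      have e : y + (h s x / h x x) • x = s := by rw [← hsy]; abel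
      refine ⟨h s x / h x x, ?_, e⟩
      simp only [Finset.mem_filter, Finset.mem_univ, true_and]
      have := H.norm_expand hyx (h s x / h x x)
      rw [e, hss, hσ] at this
      rw [eq_div_iff hxx]
      linear_combination -this
  have hfix : ∀ y, (h y y) ^ q = h y y := fun y => by rw [← hσ, H.herm]
  rw [Finset.card_eq_sum_card_fiberwise hmaps, Finset.sum_union hdisj]
  congr 1
  · rw [Finset.card_eq_sum_ones]
    refine Finset.sum_congr rfl fun y hy => ?_
    rw [mem_iso] at hy
    rw [hfib y hy.1, hy.2, Finset.card_eq_one]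
    refine ⟨0, ?_⟩
    ext c
    have : q ≠ 0 := by omega
    simp [this]
  · rw [mul_comm, ← smul_eq_mul, ← Finset.sum_const]
    refine Finset.sum_congr rfl fun y hy => ?_
    rw [mem_anis] at hy
    rw [hfib y hy.1]
    apply hh_norm_fiber q hq hK
    · exact div_ne_zero (neg_ne_zero.2 hy.2) hxx
    · rw [← hσ, map_div₀, map_neg, hσ, hσ, hfix, hfix]

theorem iso_count [Fintype K] [Fintype V] {q : ℕ} (hq : 2 ≤ q) (hK : Fintype.card K = q ^ 2)
    (hσ : ∀ x : K, σ x = x ^ q) (H : HHerm σ h) (m : ℕ) : ∀ (S : Submodule K V) (r : ℕ),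
    Module.finrank K (H.rad S) = r → Module.finrank K S = r + m →
    (q : ℚ) * (iso h S).card = q ^ (2 * (r + m)) + (-1) ^ m * (q - 1) * q ^ (2 * r + m) := by
  induction m with
  | zero =>
    intro S r hr hS
    have hrS : H.rad S = S := Submodule.eq_of_le_of_finrank_eq (H.rad_le S) (by omega)
    have : anis h S = ∅ := by
      ext x
      rw [mem_anis]
      constructor
      · rintro ⟨hx, hxx⟩
        rw [← hrS] at hx
        exact absurd (hx.2 x hx.1) hxx
      · simp
    have h1 := iso_add_anis hK h S
    rw [this, Finset.card_empty, add_zero, hS] at h1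
    rw [h1]
    push_cast
    simp
    ring
  | succ m ih =>
    intro S r hr hS
    have hex : ∃ x ∈ S, h x x ≠ 0 := by
      by_contra! hc
      have hne : ∃ x ∈ S, x ∉ H.rad S := by
        by_contra! hc'
        have : S = H.rad S := le_antisymm hc' (H.rad_le S)
        rw [← this] at hr
        omega
      obtain ⟨x, hx, hxr⟩ := hne
      have hy : ∃ y ∈ S, h x y ≠ 0 := by
        by_contra! hc'
        exact hxr ⟨hx, hc'⟩
      obtain ⟨y, hy, hxy⟩ := hy
      -- trace of c * h x y vanishes for all c
      have key : ∀ c : K, c * h x y + (c * h x y) ^ q = 0 := by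
        intro c
        have h1 := hc _ (S.add_mem (S.smul_mem c hx) hy)
        rw [H.add_left, H.add_right, H.add_right, H.smul_left, H.smul_left, H.smul_right,
          H.smul_right, hc x hx, hc y hy] at h1
        rw [← hσ, _root_.map_mul, H.herm]
        linear_combination h1
      have key2 : ∀ c : K, c + c ^ q = 0 := by
        intro c
        have := key (c / h x y)
        rwa [div_mul_cancel₀ _ hxy] at this
      -- too many roots
      open Polynomial in
      have hp : (X ^ q + X : K[X]) ≠ 0 := by
        intro h0
        have := congrArg (fun p => Polynomial.coeff p 1) h0
        simp [Polynomial.coeff_X_pow] at this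
        have h2 : q ≠ 1 := by omega
        simp [h2.symm] at this
      open Polynomial in
      have hle := Polynomial.card_roots' (X ^ q + X : K[X])
      open Polynomial in
      have hdeg : (X ^ q + X : K[X]).natDegree ≤ q := by
        compute_degree
        omega
      have hle2 : Fintype.card K ≤ q := by
        classical
        refine le_trans ?_ (hle.trans hdeg)
        rw [← Finset.card_univ]
        refine le_trans (Finset.card_le_card ?_) (Multiset.toFinset_card_le _)
        intro c _
        rw [Multiset.mem_toFinset, Polynomial.mem_roots hp]
        simp [add_comm, key2 c]
      rw [hK] at hle2
      nlinarith
    obtain ⟨x, hx, hxx⟩ := hex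
    have h1 := H.finrank_perp hx hxx
    have h2 := ih (S ⊓ H.perp x) r (by rw [H.rad_perp_anis hx hxx, hr]) (by omega)
    have h3 := H.iso_rec hq hK hσ hx hxx
    have h4 := iso_add_anis hK h (S ⊓ H.perp x)
    have h5 : Module.finrank K ↥(S ⊓ H.perp x) = r + m := by omega
    rw [h5] at h4
    have h4' : ((iso h (S ⊓ H.perp x)).card : ℚ) + (anis h (S ⊓ H.perp x)).card
      = q ^ (2 * (r + m)) := by exact_mod_cast h4
    rw [h3]
    push_cast
    have e1 : (q : ℚ) ^ (2 * (r + (m + 1))) = q ^ (2 * (r + m)) * q ^ 2 := by ring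
    have e2 : (q : ℚ) ^ (2 * r + (m + 1)) = q ^ (2 * r + m) * q := by ring
    rw [e1, e2, pow_succ]
    linear_combination (q * (q + 1) : ℚ) * h4' - q * h2

end HHerm

namespace HHerm
variable {σ : K →+* K} {h : V → V → K}

open Classical in
/-- totally isotropic subspaces of `S` containing the radical -/
def tset [Fintype V] (H : HHerm σ h) (S : Submodule K V) (j : ℕ) : Finset (Submodule K V) :=
  (Set.toFinite {W : Submodule K V | H.rad S ≤ W ∧ W ≤ S ∧
    Module.finrank K W = Module.finrank K (H.rad S) + j ∧ ∀ x ∈ W, ∀ y ∈ W, h x y = 0}).toFinset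

theorem mem_tset [Fintype V] (H : HHerm σ h) {S W : Submodule K V} {j : ℕ} :
    W ∈ H.tset S j ↔ H.rad S ≤ W ∧ W ≤ S ∧
    Module.finrank K W = Module.finrank K (H.rad S) + j ∧ ∀ x ∈ W, ∀ y ∈ W, h x y = 0 := by
  simp [tset]

/-- subspaces of `S` of dimension `k₀ + ℓ` with `ℓ`-dimensional radical -/
def xset [Fintype V] (H : HHerm σ h) (S : Submodule K V) (k₀ ℓ : ℕ) : Finset (Submodule K V) :=
  (Set.toFinite {C : Submodule K V | C ≤ S ∧
    Module.finrank K C = k₀ + ℓ ∧ Module.finrank K (H.rad C) = ℓ}).toFinset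

theorem mem_xset [Fintype V] (H : HHerm σ h) {S C : Submodule K V} {k₀ ℓ : ℕ} :
    C ∈ H.xset S k₀ ℓ ↔ C ≤ S ∧
    Module.finrank K C = k₀ + ℓ ∧ Module.finrank K (H.rad C) = ℓ := by
  simp [xset]

theorem tset_zero [Fintype K] [Fintype V] (H : HHerm σ h) (S : Submodule K V) :
    (H.tset S 0).card = 1 := by
  rw [Finset.card_eq_one]
  refine ⟨H.rad S, ?_⟩
  ext W
  rw [mem_tset, Finset.mem_singleton]
  constructor
  · rintro ⟨h1, h2, h3, h4⟩
    exact (Submodule.eq_of_le_of_finrank_eq h1 (by omega)).symm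
  · rintro rfl
    exact ⟨le_rfl, H.rad_le S, by omega, fun x hx y hy => hx.2 y hy.1⟩

open Classical in
theorem card_sdiff_sub [Fintype K] [Fintype V] {q : ℕ} (hK : Fintype.card K = q ^ 2)
    {R W : Submodule K V} (hRW : R ≤ W) :
    ((Finset.univ.filter (fun x => x ∈ W ∧ x ∉ R)).card : ℚ)
      = q ^ (2 * Module.finrank K W) - q ^ (2 * Module.finrank K R) := by
  have h1 := Finset.card_filter_add_card_filter_not (fun x => x ∈ R)
    (s := Finset.univ.filter (fun x => x ∈ W))
  rw [Finset.filter_filter, Finset.filter_filter, card_sub hK W] at h1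
  have h2 : (Finset.univ.filter (fun x => x ∈ W ∧ x ∈ R)) =
    (Finset.univ.filter (fun x => x ∈ R)) := by
    ext x
    simp only [Finset.mem_filter, Finset.mem_univ, true_and]
    exact ⟨fun h => h.2, fun h => ⟨hRW h, h⟩⟩
  rw [h2, card_sub hK R] at h1
  rw [eq_sub_iff_add_eq, add_comm]
  exact_mod_cast h1

open Classical in
theorem tset_rec [Fintype K] [Fintype V] {q : ℕ} (hK : Fintype.card K = q ^ 2)
    (H : HHerm σ h) (S : Submodule K V) (r j : ℕ) (hr : Module.finrank K (H.rad S) = r)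
    (N : ℚ) (hN : ∀ x ∈ S, h x x = 0 → x ∉ H.rad S → ((H.tset (S ⊓ H.perp x) j).card : ℚ) = N) :
    ((H.tset S (j + 1)).card : ℚ) * (q ^ (2 * (r + (j + 1))) - q ^ (2 * r)) =
      ((iso h S).card - q ^ (2 * r)) * N := by
  have hdc := Finset.sum_card_bipartiteAbove_eq_sum_card_bipartiteBelow
    (s := H.tset S (j + 1)) (t := (iso h S).filter (fun x => x ∉ H.rad S))
    (fun W x => x ∈ W)
  have hdc' := congrArg (Nat.cast : ℕ → ℚ) hdc
  push_cast at hdc'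
  have hL : ∀ W ∈ H.tset S (j + 1), ((Finset.bipartiteAbove (fun W x => x ∈ W)
      ((iso h S).filter (fun x => x ∉ H.rad S)) W).card : ℚ)
      = (q ^ (2 * (r + (j + 1))) - q ^ (2 * r)) := by
    intro W hW
    rw [mem_tset] at hW
    obtain ⟨h1, h2, h3, h4⟩ := hW
    rw [← hr, ← h3, ← card_sdiff_sub hK h1]
    congr 2
    ext x
    simp only [Finset.mem_bipartiteAbove, Finset.mem_filter, mem_iso, Finset.mem_univ, true_and]
    constructor
    · rintro ⟨⟨_, h5⟩, h6⟩
      exact ⟨h6, h5⟩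
    · rintro ⟨h5, h6⟩
      exact ⟨⟨⟨h2 h5, h4 x h5 x h5⟩, h6⟩, h5⟩
  have hR : ∀ x ∈ (iso h S).filter (fun x => x ∉ H.rad S),
      ((Finset.bipartiteBelow (fun W x => x ∈ W) (H.tset S (j + 1)) x).card : ℚ) = N := by
    intro x hx
    rw [Finset.mem_filter, mem_iso] at hx
    obtain ⟨⟨hx, hxx⟩, hxr⟩ := hx
    rw [← hN x hx hxx hxr]
    congr 2
    ext W
    rw [Finset.mem_bipartiteBelow, mem_tset, mem_tset, H.rad_perp_iso hx hxx hxr,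
      hh_finrank_sup _ x hxr, sup_le_iff, Submodule.span_singleton_le_iff_mem]
    constructor
    · rintro ⟨⟨h1, h2, h3, h4⟩, h5⟩
      exact ⟨⟨h1, h5⟩, le_inf h2 (fun y hy => h4 y hy x h5), by omega, h4⟩
    · rintro ⟨⟨h1, h5⟩, h2, h3, h4⟩
      exact ⟨⟨h1, h2.trans inf_le_left, by omega, h4⟩, h5⟩
  rw [Finset.sum_congr rfl hL, Finset.sum_congr rfl hR, Finset.sum_const, Finset.sum_const,
    nsmul_eq_mul, nsmul_eq_mul] at hdc'
  rw [hdc']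
  congr 1
  have h1 := Finset.card_filter_add_card_filter_not (fun x => x ∈ H.rad S) (s := iso h S)
  have h2 : (iso h S).filter (fun x => x ∈ H.rad S) =
      Finset.univ.filter (fun x => x ∈ H.rad S) := by
    ext x
    simp only [Finset.mem_filter, mem_iso, Finset.mem_univ, true_and]
    exact ⟨fun h => h.2, fun h => ⟨⟨h.1, h.2 x h.1⟩, h⟩⟩
  rw [h2, card_sub hK, hr] at h1
  rw [eq_sub_iff_add_eq, add_comm]
  exact_mod_cast h1

theorem tset_count [Fintype K] [Fintype V] {q : ℕ} (hq : 2 ≤ q) (hK : Fintype.card K = q ^ 2)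
    (hσ : ∀ x : K, σ x = x ^ q) (H : HHerm σ h) (j : ℕ) : ∀ (m : ℕ) (S : Submodule K V) (r : ℕ),
    Module.finrank K (H.rad S) = r → Module.finrank K S = r + (m + 2 * j) →
    ((H.tset S j).card : ℚ) =
      (∏ i ∈ Finset.range j, ((q : ℚ) ^ (m + 2 * j - 2 * i) - (-1) ^ m) *
        ((q : ℚ) ^ (m + 2 * j - 2 * i - 1) + (-1) ^ m)) /
      (∏ i ∈ Finset.range j, ((q : ℚ) ^ (2 * (i + 1)) - 1)) := by
  have hq1 : (1 : ℚ) < q := by exact_mod_cast hq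
  induction j with
  | zero =>
    intro m S r _ _
    simp [H.tset_zero S]
  | succ j ih =>
    intro m S r hr hS
    have hrec := H.tset_rec hK S r j hr _ (by
      intro x hx hxx hxr
      have hy : ∃ y ∈ S, h x y ≠ 0 := by
        by_contra! hc'
        exact hxr ⟨hx, hc'⟩
      obtain ⟨y, hy, hxy⟩ := hy
      have hyx : h y x ≠ 0 := fun h0 => hxy (H.symm_zero h0)
      have h1 := H.finrank_perp hy hyx
      refine ih m (S ⊓ H.perp x) (r + 1) ?_ (by omega)
      rw [H.rad_perp_iso hx hxx hxr, hh_finrank_sup _ x hxr, hr])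
    have hiso := H.iso_count hq hK hσ (m + 2 * (j + 1)) S r hr hS
    have hD : ∀ i : ℕ, ((q : ℚ) ^ (2 * (i + 1)) - 1) ≠ 0 := by
      intro i
      have := one_lt_pow₀ hq1 (n := 2 * (i + 1)) (by omega)
      linarith
    rw [Finset.prod_range_succ', Finset.prod_range_succ (fun i => ((q : ℚ) ^ (2 * (i + 1)) - 1))]
    have hnum : ∀ i ∈ Finset.range j, ((q : ℚ) ^ (m + 2 * (j + 1) - 2 * (i + 1)) - (-1) ^ m) *
        ((q : ℚ) ^ (m + 2 * (j + 1) - 2 * (i + 1) - 1) + (-1) ^ m) =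
        ((q : ℚ) ^ (m + 2 * j - 2 * i) - (-1) ^ m) *
        ((q : ℚ) ^ (m + 2 * j - 2 * i - 1) + (-1) ^ m) := by
      intro i _
      have : m + 2 * (j + 1) - 2 * (i + 1) = m + 2 * j - 2 * i := by omega
      rw [this]
    rw [Finset.prod_congr rfl hnum]
    set P := ∏ i ∈ Finset.range j, ((q : ℚ) ^ (m + 2 * j - 2 * i) - (-1) ^ m) *
        ((q : ℚ) ^ (m + 2 * j - 2 * i - 1) + (-1) ^ m)
    have hQ : (∏ i ∈ Finset.range j, ((q : ℚ) ^ (2 * (i + 1)) - 1)) ≠ 0 :=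
      Finset.prod_ne_zero_iff.2 fun i _ => hD i
    set Q := ∏ i ∈ Finset.range j, ((q : ℚ) ^ (2 * (i + 1)) - 1)
    have hDj := hD j
    have e0 : m + 2 * (j + 1) - 2 * 0 = (m + 2 * j + 1) + 1 := by omega
    have e1 : m + 2 * j + 1 + 1 - 1 = m + 2 * j + 1 := by omega
    have hq0 : (q : ℚ) ≠ 0 := by positivity
    rw [e0, e1, eq_div_iff (mul_ne_zero hQ hDj)]
    have hs : ((-1 : ℚ) ^ m) * (-1) ^ m = 1 := by rw [← mul_pow]; simp
    have hs2 : ((-1 : ℚ) ^ (m + 2 * (j + 1))) = (-1) ^ m := by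
      rw [pow_add, pow_mul]; simp
    have hiso2 : ((iso h S).card : ℚ) - q ^ (2 * r) = q ^ (2 * r) *
        (((q : ℚ) ^ (m + 2 * j + 1 + 1) - (-1) ^ m) * ((q : ℚ) ^ (m + 2 * j + 1) + (-1) ^ m)) := by
      apply mul_left_cancel₀ hq0
      rw [mul_sub, hiso, hs2]
      have f1 : (q : ℚ) ^ (2 * (r + (m + 2 * (j + 1)))) = q ^ (2 * r) * (q ^ (m + 2 * j + 1) * q) ^ 2 := by
        ring
      have f2 : (q : ℚ) ^ (2 * r + (m + 2 * (j + 1))) = q ^ (2 * r) * (q ^ (m + 2 * j + 1) * q) := by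
        ring
      rw [f1, f2, pow_succ _ (m + 2 * j + 1)]
      linear_combination (q * (q : ℚ) ^ (2 * r)) * hs
    rw [hiso2] at hrec
    have hr0 : (q : ℚ) ^ (2 * r) ≠ 0 := pow_ne_zero _ hq0
    apply mul_left_cancel₀ hr0
    have f3 : (q : ℚ) ^ (2 * (r + (j + 1))) = q ^ (2 * r) * q ^ (2 * (j + 1)) := by ring
    rw [f3] at hrec
    have f4 : P / Q * Q = P := div_mul_cancel₀ _ hQ
    rw [← f4]
    linear_combination Q * hrec

open Classical in
theorem xset_rec [Fintype K] [Fintype V] (H : HHerm σ h) (S : Submodule K V) (k₀ ℓ : ℕ)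
    (N A : ℚ) (hA : ∀ C ∈ H.xset S (k₀ + 1) ℓ, ((anis h C).card : ℚ) = A)
    (hN : ∀ x ∈ S, h x x ≠ 0 → ((H.xset (S ⊓ H.perp x) k₀ ℓ).card : ℚ) = N) :
    ((H.xset S (k₀ + 1) ℓ).card : ℚ) * A = (anis h S).card * N := by
  have hdc := Finset.sum_card_bipartiteAbove_eq_sum_card_bipartiteBelow
    (s := H.xset S (k₀ + 1) ℓ) (t := anis h S) (fun C x => x ∈ C)
  have hdc' := congrArg (Nat.cast : ℕ → ℚ) hdc
  push_cast at hdc'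
  have hL : ∀ C ∈ H.xset S (k₀ + 1) ℓ,
      ((Finset.bipartiteAbove (fun C x => x ∈ C) (anis h S) C).card : ℚ) = A := by
    intro C hC
    rw [← hA C hC]
    congr 2
    ext x
    simp only [Finset.mem_bipartiteAbove, mem_anis]
    exact ⟨fun h => ⟨h.2, h.1.2⟩, fun h => ⟨⟨((H.mem_xset).1 hC).1 h.1, h.2⟩, h.1⟩⟩
  have hR : ∀ x ∈ anis h S,
      ((Finset.bipartiteBelow (fun C x => x ∈ C) (H.xset S (k₀ + 1) ℓ) x).card : ℚ) = N := by
    intro x hx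
    rw [mem_anis] at hx
    obtain ⟨hx, hxx⟩ := hx
    rw [← hN x hx hxx]
    congr 1
    have hback : ∀ D : Submodule K V, D ≤ S ⊓ H.perp x →
        (D ⊔ Submodule.span K {x}) ⊓ H.perp x = D := by
      intro D hD
      apply le_antisymm
      · rintro z ⟨hz, hzx⟩
        rw [SetLike.mem_coe, Submodule.mem_sup] at hz
        obtain ⟨d, hd, w, hw, rfl⟩ := hz
        obtain ⟨c, rfl⟩ := Submodule.mem_span_singleton.1 hw
        have hzx' : h (d + c • x) x = 0 := hzx
        have hdx : h d x = 0 := (hD hd).2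
        rw [H.add_left, hdx, H.smul_left, zero_add] at hzx'
        have hc : c = 0 := (mul_eq_zero.1 hzx').resolve_right hxx
        rw [hc, zero_smul, add_zero]
        exact hd
      · exact le_inf le_sup_left (hD.trans inf_le_right)
    refine Finset.card_bij' (fun C _ => C ⊓ H.perp x) (fun D _ => D ⊔ Submodule.span K {x})
      ?_ ?_ ?_ ?_
    · intro C hC
      rw [Finset.mem_bipartiteBelow, mem_xset] at hC
      obtain ⟨⟨h1, h2, h3⟩, h4⟩ := hC
      have := H.finrank_perp h4 hxx
      rw [mem_xset, H.rad_perp_anis h4 hxx]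
      exact ⟨inf_le_inf_right _ h1, by omega, h3⟩
    · intro D hD
      rw [mem_xset] at hD
      obtain ⟨h1, h2, h3⟩ := hD
      have hxm : x ∈ D ⊔ Submodule.span K {x} :=
        Submodule.mem_sup_right (Submodule.mem_span_singleton_self x)
      have hxD : x ∉ D := fun hh => hxx (h1 hh).2
      rw [Finset.mem_bipartiteBelow, mem_xset, ← H.rad_perp_anis hxm hxx, hback D h1,
        hh_finrank_sup D x hxD, sup_le_iff, Submodule.span_singleton_le_iff_mem]
      exact ⟨⟨⟨h1.trans inf_le_left, hx⟩, by omega, h3⟩, hxm⟩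
    · intro C hC
      rw [Finset.mem_bipartiteBelow, mem_xset] at hC
      exact H.sup_eq hC.2 hxx
    · intro D hD
      rw [mem_xset] at hD
      exact hback D hD.1
  rw [Finset.sum_congr rfl hL, Finset.sum_congr rfl hR, Finset.sum_const, Finset.sum_const,
    nsmul_eq_mul, nsmul_eq_mul] at hdc'
  exact hdc'

theorem anis_count [Fintype K] [Fintype V] {q : ℕ} (hq : 2 ≤ q) (hK : Fintype.card K = q ^ 2)
    (hσ : ∀ x : K, σ x = x ^ q) (H : HHerm σ h) (m : ℕ) (S : Submodule K V) (r : ℕ)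
    (hr : Module.finrank K (H.rad S) = r) (hS : Module.finrank K S = r + m) :
    ((anis h S).card : ℚ) = (q - 1) / q * (q ^ (2 * r + m) * (q ^ m - (-1) ^ m)) := by
  have h1 := H.iso_count hq hK hσ m S r hr hS
  have h2 := iso_add_anis hK h S
  rw [hS] at h2
  have h2' : ((iso h S).card : ℚ) + (anis h S).card = q ^ (2 * (r + m)) := by exact_mod_cast h2
  have hq0 : (q : ℚ) ≠ 0 := by positivity
  field_simp
  have e : (q : ℚ) ^ (2 * (r + m)) = q ^ (2 * r + m) * q ^ m := by ring
  rw [e] at h1 h2'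
  linear_combination q * h2' - h1

theorem xset_count [Fintype K] [Fintype V] {q : ℕ} (hq : 2 ≤ q) (hK : Fintype.card K = q ^ 2)
    (hσ : ∀ x : K, σ x = x ^ q) (H : HHerm σ h) (m ℓ : ℕ) (k₀ : ℕ) : ∀ (S : Submodule K V),
    H.rad S = ⊥ → Module.finrank K S = m + 2 * ℓ + k₀ →
    ((H.xset S k₀ ℓ).card : ℚ) =
      (∏ i ∈ Finset.range ℓ, ((q : ℚ) ^ (m + 2 * ℓ - 2 * i) - (-1) ^ m) *
        ((q : ℚ) ^ (m + 2 * ℓ - 2 * i - 1) + (-1) ^ m)) /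
      (∏ i ∈ Finset.range ℓ, ((q : ℚ) ^ (2 * (i + 1)) - 1)) *
      ((q : ℚ) ^ (k₀ * m) * ∏ i ∈ Finset.range k₀,
        ((q : ℚ) ^ (m + 2 * ℓ + (i + 1)) - (-1) ^ (m + 2 * ℓ + (i + 1))) /
          ((q : ℚ) ^ (i + 1) - (-1) ^ (i + 1))) := by
  have hq1 : (1 : ℚ) < q := by exact_mod_cast hq
  induction k₀ with
  | zero =>
    intro S hr hS
    rw [← H.tset_count hq hK hσ ℓ m S 0 (by rw [hr, finrank_bot]) (by omega)]
    have : H.xset S 0 ℓ = H.tset S ℓ := by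
      ext C
      rw [mem_xset, mem_tset, hr, finrank_bot]
      constructor
      · rintro ⟨h1, h2, h3⟩
        have hC : H.rad C = C := Submodule.eq_of_le_of_finrank_eq (H.rad_le C) (by omega)
        refine ⟨bot_le, h1, h2, fun x hx y hy => ?_⟩
        rw [← hC] at hx
        exact hx.2 y hy
      · rintro ⟨_, h1, h2, h3⟩
        have hC : H.rad C = C := le_antisymm (H.rad_le C) (fun x hx => ⟨hx, h3 x hx⟩)
        refine ⟨h1, h2, by rw [hC]; omega⟩
    rw [this]
    simp
  | succ k₀ ih =>
    intro S hr hS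
    have hrec := H.xset_rec S k₀ ℓ _ _ (by
      intro C hC
      rw [mem_xset] at hC
      exact H.anis_count hq hK hσ (k₀ + 1) C ℓ hC.2.2 (by omega)) (by
      intro x hx hxx
      have h1 := H.finrank_perp hx hxx
      exact ih (S ⊓ H.perp x) (by rw [H.rad_perp_anis hx hxx, hr]) (by omega))
    rw [H.anis_count hq hK hσ (m + 2 * ℓ + (k₀ + 1)) S 0 (by rw [hr, finrank_bot]) (by omega)] at hrec
    rw [Finset.prod_range_succ]
    set T := (∏ i ∈ Finset.range ℓ, ((q : ℚ) ^ (m + 2 * ℓ - 2 * i) - (-1) ^ m) *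
        ((q : ℚ) ^ (m + 2 * ℓ - 2 * i - 1) + (-1) ^ m)) /
      (∏ i ∈ Finset.range ℓ, ((q : ℚ) ^ (2 * (i + 1)) - 1))
    set P := ∏ i ∈ Finset.range k₀,
        ((q : ℚ) ^ (m + 2 * ℓ + (i + 1)) - (-1) ^ (m + 2 * ℓ + (i + 1))) /
          ((q : ℚ) ^ (i + 1) - (-1) ^ (i + 1))
    have hq0 : (q : ℚ) ≠ 0 := by positivity
    have hqm : (q : ℚ) - 1 ≠ 0 := by linarith
    have hd : ((q : ℚ) ^ (k₀ + 1) - (-1) ^ (k₀ + 1)) ≠ 0 := by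
      have h1 := one_lt_pow₀ hq1 (n := k₀ + 1) (by omega)
      rcases neg_one_pow_eq_or ℚ (k₀ + 1) with h2 | h2 <;> rw [h2] <;> linarith
    set U := (q : ℚ) ^ (m + 2 * ℓ + (k₀ + 1)) - (-1) ^ (m + 2 * ℓ + (k₀ + 1))
    set D := ((q : ℚ) ^ (k₀ + 1) - (-1) ^ (k₀ + 1))
    have hne : (q - 1) / q * ((q : ℚ) ^ (2 * ℓ + (k₀ + 1)) * D) ≠ 0 := by positivity
    apply mul_right_cancel₀ hne
    rw [hrec]
    have e1 : (q : ℚ) ^ (2 * 0 + (m + 2 * ℓ + (k₀ + 1))) = q ^ (2 * ℓ + (k₀ + 1)) * q ^ m := by ring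
    have e2 : (q : ℚ) ^ ((k₀ + 1) * m) = q ^ (k₀ * m) * q ^ m := by ring
    rw [e1, e2]
    field_simp

end HHerm

end HermAux

theorem hh_prod_Icc (f : ℕ → ℚ) (l : ℕ) :
    ∏ i ∈ Finset.Icc 1 l, f i = ∏ i ∈ Finset.range l, f (i + 1) := by
  induction l with
  | zero => simp
  | succ l ih => rw [Finset.prod_Icc_succ_top (by omega), ih, Finset.prod_range_succ]

theorem hh_herm {K : Type*} [Field K] [Fintype K] {q : ℕ} (hK : Fintype.card K = q ^ 2)
    (σ : K →+* K) (hσ : ∀ x : K, σ x = x ^ q) (n : ℕ) :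
    HHerm σ (hermInner σ : (Fin n → K) → (Fin n → K) → K) where
  add_left := by
    intro x y z
    simp [hermInner, add_mul, Finset.sum_add_distrib]
  smul_left := by
    intro c x z
    simp [hermInner, Finset.mul_sum, mul_assoc]
  herm := by
    intro x y
    have hh : ∀ c : K, σ (σ c) = c := by
      intro c
      rw [hσ, hσ, ← pow_mul, ← sq, ← hK, FiniteField.pow_card]
    simp [hermInner, hh, mul_comm]

/-- The mass formula for linear `[n,k]_{q²}` codes with `ℓ`-dimensional
Hermitian hull (`k₀ = k - ℓ`). -/
theorem card_hermitian_hull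
    (q : ℕ) (hq : IsPrimePow q)
    {K : Type*} [Field K] [Fintype K] (hK : Fintype.card K = q ^ 2)
    (σ : K →+* K) (hσ : ∀ x : K, σ x = x ^ q)
    (n k ℓ : ℕ) (hn : 0 < n) (hk : 0 < k) (hℓ : 0 < ℓ)
    (hℓk : ℓ ≤ k) (hkn : k + ℓ ≤ n)
    (k₀ : ℕ) (hk₀ : k₀ = k - ℓ) :
    (Nat.card {C : Submodule K (Fin n → K) //
        Module.finrank K C = k ∧ Module.finrank K ↥(C ⊓ hermDual σ C) = ℓ} : ℚ) =
      (if Odd (n - k₀) then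
          ∏ i ∈ Finset.Icc 1 ℓ,
            ((q : ℚ) ^ (n - k₀ - 2 * i + 2) + 1) * ((q : ℚ) ^ (n - k₀ - 2 * i + 1) - 1) /
              ((q : ℚ) ^ (2 * k₀) * ((q : ℚ) ^ (2 * i) - 1))
        else
          ∏ i ∈ Finset.Icc 1 ℓ,
            ((q : ℚ) ^ (n - k₀ - 2 * i + 2) - 1) * ((q : ℚ) ^ (n - k₀ - 2 * i + 1) + 1) /
              ((q : ℚ) ^ (2 * k₀) * ((q : ℚ) ^ (2 * i) - 1))) *
        ((q : ℚ) ^ (k₀ * (n - k₀)) *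
          ∏ i ∈ Finset.Icc 1 k₀,
            ((q : ℚ) ^ (n - k₀ + i) - (-1) ^ (n - k₀ + i)) / ((q : ℚ) ^ i - (-1) ^ i)) := by
  have hq2 : 2 ≤ q := hq.two_le
  have H := hh_herm hK σ hσ n
  have hrad : H.rad ⊤ = ⊥ := by
    rw [eq_bot_iff]
    rintro z ⟨_, hz⟩
    rw [Submodule.mem_bot]
    funext i
    have := hz (Pi.single i 1) trivial
    simpa [hermInner, Pi.single_apply, apply_ite σ] using this
  obtain ⟨m, hm⟩ : ∃ m, n = m + 2 * ℓ + k₀ := ⟨n - k - ℓ, by omega⟩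
  have hc := H.xset_count hq2 hK hσ m ℓ k₀ ⊤ hrad (by rw [finrank_top]; simp [hm])
  have hcard : Nat.card {C : Submodule K (Fin n → K) //
        Module.finrank K C = k ∧ Module.finrank K ↥(C ⊓ hermDual σ C) = ℓ} =
        (H.xset ⊤ k₀ ℓ).card := by
    rw [← Nat.card_eq_finsetCard]
    apply Nat.card_congr
    apply Equiv.subtypeEquivRight
    intro C
    have h1 : C ⊓ hermDual σ C = H.rad C := by
      ext z
      exact ⟨fun hz => ⟨hz.1, fun x hx => H.symm_zero (hz.2 x hx)⟩,
        fun hz => ⟨hz.1, fun x hx => H.symm_zero (hz.2 x hx)⟩⟩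
    have h2 : k = k₀ + ℓ := by omega
    rw [h1, h2, H.mem_xset]
    simp
  rw [hcard, hc]
  have hnk : n - k₀ = m + 2 * ℓ := by omega
  have hq0 : (q : ℚ) ≠ 0 := by positivity
  rw [hnk, hh_prod_Icc _ k₀]
  have hAB : (if Odd (m + 2 * ℓ) then
          ∏ i ∈ Finset.Icc 1 ℓ,
            ((q : ℚ) ^ (m + 2 * ℓ - 2 * i + 2) + 1) * ((q : ℚ) ^ (m + 2 * ℓ - 2 * i + 1) - 1) /
              ((q : ℚ) ^ (2 * k₀) * ((q : ℚ) ^ (2 * i) - 1))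
        else
          ∏ i ∈ Finset.Icc 1 ℓ,
            ((q : ℚ) ^ (m + 2 * ℓ - 2 * i + 2) - 1) * ((q : ℚ) ^ (m + 2 * ℓ - 2 * i + 1) + 1) /
              ((q : ℚ) ^ (2 * k₀) * ((q : ℚ) ^ (2 * i) - 1))) =
      (∏ i ∈ Finset.range ℓ, ((q : ℚ) ^ (m + 2 * ℓ - 2 * i) - (-1) ^ m) *
        ((q : ℚ) ^ (m + 2 * ℓ - 2 * i - 1) + (-1) ^ m)) /
      (((q : ℚ) ^ (2 * k₀)) ^ ℓ * ∏ i ∈ Finset.range ℓ, ((q : ℚ) ^ (2 * (i + 1)) - 1)) := by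
    have hpow : ((q : ℚ) ^ (2 * k₀)) ^ ℓ = ∏ i ∈ Finset.range ℓ, (q : ℚ) ^ (2 * k₀) := by
      simp
    rw [hpow, ← Finset.prod_mul_distrib, ← Finset.prod_div_distrib]
    have hodd : Odd (m + 2 * ℓ) ↔ Odd m := by
      simp [Nat.odd_add]
    split_ifs with ho
    · rw [hodd] at ho
      rw [hh_prod_Icc]
      refine Finset.prod_congr rfl fun i hi => ?_
      have hi' := Finset.mem_range.1 hi
      have e1 : m + 2 * ℓ - 2 * (i + 1) + 2 = m + 2 * ℓ - 2 * i := by omega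
      have e2 : m + 2 * ℓ - 2 * (i + 1) + 1 = m + 2 * ℓ - 2 * i - 1 := by omega
      rw [e1, e2, ho.neg_one_pow, sub_neg_eq_add, ← sub_eq_add_neg]
    · rw [hodd, Nat.not_odd_iff_even] at ho
      rw [hh_prod_Icc]
      refine Finset.prod_congr rfl fun i hi => ?_
      have hi' := Finset.mem_range.1 hi
      have e1 : m + 2 * ℓ - 2 * (i + 1) + 2 = m + 2 * ℓ - 2 * i := by omega
      have e2 : m + 2 * ℓ - 2 * (i + 1) + 1 = m + 2 * ℓ - 2 * i - 1 := by omega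
      rw [e1, e2, ho.neg_one_pow]
  rw [hAB]
  have e3 : (q : ℚ) ^ (k₀ * (m + 2 * ℓ)) = ((q : ℚ) ^ (2 * k₀)) ^ ℓ * q ^ (k₀ * m) := by
    rw [← pow_mul, ← pow_add]
    congr 1
    ring
  rw [e3]
  have hne : ((q : ℚ) ^ (2 * k₀)) ^ ℓ ≠ 0 := by positivity
  rw [div_mul_eq_div_div_swap]
  generalize (((q : ℚ) ^ (2 * k₀)) ^ ℓ) = Z at hne ⊢
  rw [mul_assoc Z, ← mul_assoc (_ / Z), div_mul_cancel₀ _ hne]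
end
end

section
/- Let q be a prime power and let n, k be positive integers with 2k ≤ n. The number of Hermitian self-orthogonal [n,k]_{q²} codes (k-dimensional subspaces C of F_{q²}^n with C ⊆ C^{⊥H}) equals ∏_{i=1}^{k} ( q^{n−2i+1}(q^{n−2i+2} + (−1)^n (q − 1)) − 1 ) / (q^{2i} − 1). -/
open scoped BigOperators
open Matrix

noncomputable section

section aux

variable {K : Type*} [Field K] {n : ℕ} (σ : K →+* K)

lemma mem_hermDual {C : Submodule K (Fin n → K)} {y : Fin n → K} :
    y ∈ hermDual σ C ↔ ∀ x ∈ C, hermInner σ x y = 0 := Iff.rfl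

variable {σ} in
lemma hI_symm (hs : ∀ x, σ (σ x) = x) (x y : Fin n → K) :
    σ (hermInner σ x y) = hermInner σ y x := by
  simp only [hermInner, map_sum, map_mul, hs]
  exact Finset.sum_congr rfl fun i _ => by ring

variable {σ} in
lemma hI_symm_zero (hs : ∀ x, σ (σ x) = x) {x y : Fin n → K} (h : hermInner σ x y = 0) :
    hermInner σ y x = 0 := by
  rw [← hI_symm hs, h, map_zero]

lemma sigma_sigma {q : ℕ} [Fintype K] (hK : Fintype.card K = q ^ 2)
    (hσ : ∀ x : K, σ x = x ^ q) (x : K) : σ (σ x) = x := by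
  rw [hσ, hσ, ← pow_mul, ← sq, ← hK, FiniteField.pow_card]

lemma norm_fiber {q : ℕ} (hq : 1 < q) [Fintype K] (hK : Fintype.card K = q ^ 2)
    (hσ : ∀ x : K, σ x = x ^ q) (t : K) (ht : t ≠ 0) (hst : σ t = t) :
    Nat.card {c : K // c * σ c = t} = q + 1 := by
  obtain ⟨p, rfl⟩ : ∃ p, q = p + 1 := ⟨q - 1, by omega⟩
  have hp : 0 < p := by omega
  have hcu : Nat.card Kˣ = p * (p + 1 + 1) := by
    rw [Nat.card_units, Nat.card_eq_fintype_card, hK]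
    have : (p + 1) ^ 2 = p * (p + 1 + 1) + 1 := by ring
    omega
  have hker := IsCyclic.card_powMonoidHom_ker (G := Kˣ) (p + 1 + 1)
  have hker2 := IsCyclic.card_powMonoidHom_ker (G := Kˣ) p
  have hran := IsCyclic.card_powMonoidHom_range (G := Kˣ) (p + 1 + 1)
  rw [hcu, Nat.gcd_eq_right (Dvd.intro_left _ rfl)] at hker hran
  rw [hcu, Nat.gcd_eq_right (Dvd.intro _ rfl)] at hker2
  rw [Nat.mul_div_cancel _ (by omega)] at hran
  have heq : (powMonoidHom (p + 1 + 1) : Kˣ →* Kˣ).range = (powMonoidHom p : Kˣ →* Kˣ).ker := by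
    apply Subgroup.eq_of_le_of_card_ge
    · rintro _ ⟨x, rfl⟩
      rw [MonoidHom.mem_ker]
      simp only [powMonoidHom_apply]
      rw [← pow_mul, mul_comm, ← hcu]
      exact pow_card_eq_one'
    · rw [hker2, hran]
  have hmem : Units.mk0 t ht ∈ (powMonoidHom (p + 1 + 1) : Kˣ →* Kˣ).range := by
    rw [heq, MonoidHom.mem_ker, powMonoidHom_apply]
    ext
    rw [hσ, pow_succ] at hst
    simpa using mul_right_cancel₀ ht (hst.trans (one_mul t).symm)
  obtain ⟨c0, hc0⟩ := hmem
  have hc0' : (c0 : K) ^ (p + 1 + 1) = t := by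
    have := congrArg Units.val hc0
    simpa using this
  rw [← hker]
  symm
  refine Nat.card_congr (Equiv.ofBijective (fun u => ⟨(c0 : K) * (u.1 : Kˣ), ?_⟩) ⟨?_, ?_⟩)
  · have h1 := u.2
    rw [MonoidHom.mem_ker, powMonoidHom_apply] at h1
    have h2 := congrArg Units.val h1
    simp only [Units.val_pow_eq_pow_val, Units.val_one] at h2
    rw [hσ, ← pow_succ', mul_pow, hc0', h2, mul_one]
  · intro u v huv
    simp only [Subtype.mk.injEq, mul_eq_mul_left_iff, Units.ne_zero, or_false] at huv
    exact Subtype.ext (Units.ext huv)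
  · rintro ⟨c, hc⟩
    rw [hσ, ← pow_succ'] at hc
    have hcn : c ≠ 0 := by rintro rfl; simp at hc; exact ht hc.symm
    refine ⟨⟨c0⁻¹ * Units.mk0 c hcn, ?_⟩, ?_⟩
    · rw [MonoidHom.mem_ker, powMonoidHom_apply]
      ext
      simp [mul_pow, hc0', hc, ht]
    · simp

lemma exists_trace {q : ℕ} (hq : 1 < q) [Fintype K] (hK : Fintype.card K = q ^ 2)
    (hσ : ∀ x : K, σ x = x ^ q) : ∃ d : K, d + σ d ≠ 0 := by
  by_contra! h
  have hdeg : (Polynomial.X ^ q + Polynomial.X : Polynomial K).natDegree = q := by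
    rw [Polynomial.natDegree_add_eq_left_of_natDegree_lt] <;> simp [hq]
  have hne : (Polynomial.X ^ q + Polynomial.X : Polynomial K) ≠ 0 := by
    intro h0; rw [h0] at hdeg; simp at hdeg; omega
  have := Polynomial.card_le_degree_of_subset_roots (p := (Polynomial.X ^ q + Polynomial.X : Polynomial K))
    (Z := Finset.univ) (by
      intro x _
      rw [Polynomial.mem_roots hne]
      simp [Polynomial.IsRoot, ← hσ, add_comm, h])
  rw [hdeg, Finset.card_univ, hK] at this
  nlinarith

lemma exists_aniso {q : ℕ} (hq : 1 < q) [Fintype K] (hK : Fintype.card K = q ^ 2)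
    (hσ : ∀ x : K, σ x = x ^ q) (W : Submodule K (Fin n → K)) (hW : ¬ W ≤ hermDual σ W) :
    ∃ v ∈ W, hermInner σ v v ≠ 0 := by
  have hs := sigma_sigma σ hK hσ
  by_contra! h
  apply hW
  intro y hy x hx
  by_contra hb
  obtain ⟨d, hd⟩ := exists_trace σ hq hK hσ
  apply hd
  have h2 := h (x + σ (d / hermInner σ x y) • y) (W.add_mem hx (W.smul_mem _ hy))
  rw [hI_add_left, hI_add_right, hI_add_right, hI_smul_left, hI_smul_left, hI_smul_right,
    hI_smul_right, h x hx, h y hy, hs, ← hI_symm hs x y, ← map_mul, div_mul_cancel₀ _ hb] at h2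
  simpa using h2

lemma finrank_hermDual {q : ℕ} [Fintype K] (hK : Fintype.card K = q ^ 2)
    (hσ : ∀ x : K, σ x = x ^ q) (C : Submodule K (Fin n → K)) :
    Module.finrank K C + Module.finrank K (hermDual σ C) = n := by
  have hs := sigma_sigma σ hK hσ
  let e := dotProductEquiv K (Fin n)
  let O : Submodule K (Fin n → K) := C.dualAnnihilator.comap e.toLinearMap
  have hO : ∀ y, y ∈ O ↔ ∀ x ∈ C, ∑ i, x i * y i = 0 := by
    intro y
    simp only [O, Submodule.mem_comap, Submodule.mem_dualAnnihilator, e]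
    refine forall₂_congr fun x _ => ?_
    simp [dotProductEquiv, dotProduct, mul_comm]
  have h1 : Module.finrank K O = Module.finrank K C.dualAnnihilator :=
    LinearEquiv.finrank_eq (e.ofSubmodule' C.dualAnnihilator)
  have h2 := Subspace.finrank_add_finrank_dualAnnihilator_eq C
  have h3 : Nat.card (hermDual σ C) = Nat.card O := by
    refine Nat.card_congr ⟨fun y => ⟨fun i => σ (y.1 i), (hO _).2 y.2⟩,
      fun y => ⟨fun i => σ (y.1 i), ?_⟩, ?_, ?_⟩
    · intro x hx
      have := (hO _).1 y.2 x hx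
      simpa [hermInner, hs] using this
    · intro y; ext; simp [hs]
    · intro y; ext; simp [hs]
  rw [Module.natCard_eq_pow_finrank (K := K) (V := hermDual σ C),
    Module.natCard_eq_pow_finrank (K := K) (V := O)] at h3
  have h4 := Nat.pow_right_injective (Finite.one_lt_card (α := K)) h3
  rw [h4, h1, h2]; simp

lemma hermDual_hermDual {q : ℕ} [Fintype K] (hK : Fintype.card K = q ^ 2)
    (hσ : ∀ x : K, σ x = x ^ q) (C : Submodule K (Fin n → K)) :
    hermDual σ (hermDual σ C) = C := by
  have hs := sigma_sigma σ hK hσ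
  symm
  apply Submodule.eq_of_le_of_finrank_eq
  · intro x hx y hy
    exact hI_symm_zero hs (hy x hx)
  · have h1 := finrank_hermDual σ hK hσ C
    have h2 := finrank_hermDual σ hK hσ (hermDual σ C)
    omega

lemma card_sub {q : ℕ} [Fintype K] (hK : Fintype.card K = q ^ 2)
    (W : Submodule K (Fin n → K)) : Nat.card W = q ^ (2 * Module.finrank K W) := by
  rw [Module.natCard_eq_pow_finrank (K := K) (V := W), Nat.card_eq_fintype_card, hK, pow_mul]

/-- decomposition along an anisotropic vector -/
def isoDecomp (hs : ∀ x, σ (σ x) = x) (W : Submodule K (Fin n → K)) (v : Fin n → K) (hv : v ∈ W)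
    (ha : hermInner σ v v ≠ 0) :
    (Σ _ : ↥(W ⊓ hermDual σ (Submodule.span K {v})), K) ≃ W where
  toFun p := ⟨p.2 • v + p.1.1, W.add_mem (W.smul_mem _ hv) p.1.2.1⟩
  invFun x := ⟨⟨x.1 - (hermInner σ x.1 v / hermInner σ v v) • v,
    W.sub_mem x.2 (W.smul_mem _ hv), by
      intro y hy
      obtain ⟨c, rfl⟩ := Submodule.mem_span_singleton.1 hy
      rw [hI_smul_left, sub_eq_add_neg, ← neg_smul, hI_add_right, hI_smul_right, map_neg,
        map_div₀, hI_symm hs, hI_symm hs]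
      field_simp
      ring⟩, hermInner σ x.1 v / hermInner σ v v⟩
  left_inv := by
    rintro ⟨⟨w, hw1, hw2⟩, c⟩
    have h0 : hermInner σ w v = 0 := hI_symm_zero hs (hw2 v (Submodule.mem_span_singleton_self v))
    have h1 : hermInner σ (c • v + w) v / hermInner σ v v = c := by
      rw [hI_add_left, hI_smul_left, h0]; field_simp; simp
    simp [h1]
  right_inv := by
    rintro ⟨x, hx⟩
    simp

lemma card_iso {q : ℕ} (hq : 1 < q) [Fintype K] (hK : Fintype.card K = q ^ 2)
    (hσ : ∀ x : K, σ x = x ^ q) (d : ℕ) : ∀ (W : Submodule K (Fin n → K)),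
    Module.finrank K W = d →
    (q : ℚ) * Nat.card {x : W // hermInner σ x.1 x.1 = 0} =
      q ^ (2 * d) + (-1) ^ (d + Module.finrank K ↥(W ⊓ hermDual σ W)) *
        q ^ (d + Module.finrank K ↥(W ⊓ hermDual σ W)) * ((q : ℚ) - 1) := by
  have hs := sigma_sigma σ hK hσ
  have triv : ∀ (d : ℕ) (W : Submodule K (Fin n → K)),
    Module.finrank K W = d → W ≤ hermDual σ W →
    (q : ℚ) * Nat.card {x : W // hermInner σ x.1 x.1 = 0} =
      q ^ (2 * d) + (-1) ^ (d + Module.finrank K ↥(W ⊓ hermDual σ W)) *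
        q ^ (d + Module.finrank K ↥(W ⊓ hermDual σ W)) * ((q : ℚ) - 1) := by
    intro d W hd hW
    rw [inf_eq_left.2 hW, hd, ← two_mul, pow_mul (-1 : ℚ) 2 d]
    have : Nat.card {x : W // hermInner σ x.1 x.1 = 0} = Nat.card W :=
      Nat.card_congr (Equiv.subtypeUnivEquiv fun x => hW x.2 x.1 x.2)
    rw [this, card_sub hK, hd]
    push_cast
    norm_num
    ring
  induction d with
  | zero =>
    intro W hd
    refine triv 0 W hd ?_
    rw [Submodule.finrank_eq_zero.1 hd]
    exact bot_le
  | succ d ih =>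
    intro W hd
    by_cases hW : W ≤ hermDual σ W
    · exact triv _ W hd hW
    obtain ⟨v, hv, ha⟩ := exists_aniso σ hq hK hσ W hW
    set W' := W ⊓ hermDual σ (Submodule.span K {v}) with hW'
    obtain ⟨E, hE⟩ : ∃ E : (Σ _ : W', K) ≃ W,
      ∀ w c, (E ⟨w, c⟩).1 = c • v + w.1 := ⟨isoDecomp σ hs W v hv ha, fun _ _ => rfl⟩
    have hvW' : ∀ w ∈ W', hermInner σ v w = 0 := fun w hw =>
      hw.2 v (Submodule.mem_span_singleton_self v)
    have hcard : Nat.card W = Nat.card W' * Nat.card K := by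
      rw [← Nat.card_congr E, Nat.card_congr (Equiv.sigmaEquivProd _ _), Nat.card_prod]
    have hd' : Module.finrank K W' = d := by
      rw [card_sub hK, card_sub hK, Nat.card_eq_fintype_card, hK, ← pow_add, hd] at hcard
      have := Nat.pow_right_injective hq hcard
      omega
    have hrad : W' ⊓ hermDual σ W' = W ⊓ hermDual σ W := by
      apply le_antisymm
      · rintro x ⟨hx1, hx2⟩
        refine ⟨hx1.1, fun y hy => ?_⟩
        obtain ⟨⟨w, c⟩, hwc⟩ := E.surjective ⟨y, hy⟩
        have : c • v + w.1 = y := (hE w c).symm.trans (congrArg Subtype.val hwc)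
        rw [← this, hI_add_left, hI_smul_left, hvW' x hx1, hx2 w.1 w.2]
        simp
      · rintro x ⟨hx1, hx2⟩
        refine ⟨⟨hx1, fun y hy => hx2 y ?_⟩, fun y hy => hx2 y hy.1⟩
        exact (Submodule.span_singleton_le_iff_mem _ _).2 hv hy
    have ih' := ih W' hd'
    rw [hrad] at ih'
    generalize Module.finrank K ↥(W ⊓ hermDual σ W) = r at ih' ⊢
    set a := hermInner σ v v with ha'
    have hexp : ∀ (w : W') (c : K), hermInner σ (E ⟨w, c⟩).1 (E ⟨w, c⟩).1 =
        c * σ c * a + hermInner σ w.1 w.1 := by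
      intro w c
      rw [hE, hI_add_left, hI_add_right, hI_add_right, hI_smul_left, hI_smul_left, hI_smul_right,
        hI_smul_right, hvW' w.1 w.2, hI_symm_zero hs (hvW' w.1 w.2)]
      ring
    have e2 : {x : W // hermInner σ x.1 x.1 = 0} ≃
        Σ w : W', {c : K // c * σ c * a + hermInner σ w.1 w.1 = 0} := by
      refine (Equiv.subtypeEquiv E.symm (q := fun p =>
        p.2 * σ p.2 * a + hermInner σ p.1.1 p.1.1 = 0) ?_).trans ?_
      · intro x
        rw [← hexp]
        change _ ↔ hermInner σ (E (E.symm x)).1 (E (E.symm x)).1 = 0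
        rw [E.apply_symm_apply]
      · exact ⟨fun p => ⟨p.1.1, ⟨p.1.2, p.2⟩⟩, fun p => ⟨⟨p.1, p.2.1⟩, p.2.2⟩,
          fun _ => rfl, fun _ => rfl⟩
    classical
    have hfib : ∀ w : W', Nat.card {c : K // c * σ c * a + hermInner σ w.1 w.1 = 0} =
        if hermInner σ w.1 w.1 = 0 then 1 else q + 1 := by
      intro w
      split_ifs with h0
      · rw [Nat.card_eq_one_iff_unique]
        refine ⟨⟨?_⟩, ⟨⟨0, by simp [h0]⟩⟩⟩
        have : ∀ c : K, c * σ c * a + hermInner σ w.1 w.1 = 0 → c = 0 := by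
          intro c hc
          simpa [h0, ha] using hc
        rintro ⟨c, hc⟩ ⟨c', hc'⟩
        simp [this c hc, this c' hc']
      · rw [← norm_fiber σ hq hK hσ (-hermInner σ w.1 w.1 / a) (by simp [h0, ha])
          (by rw [map_div₀, map_neg, hI_symm hs, ha', hI_symm hs])]
        refine Nat.card_congr (Equiv.subtypeEquivRight fun c => ?_)
        rw [eq_div_iff ha, eq_neg_iff_add_eq_zero]
    have hZ : (Nat.card {x : W // hermInner σ x.1 x.1 = 0} : ℚ) =
        Nat.card {x : W' // hermInner σ x.1 x.1 = 0} +
        (q + 1) * (Nat.card W' - Nat.card {x : W' // hermInner σ x.1 x.1 = 0}) := by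
      rw [Nat.card_congr e2, Nat.card_sigma]
      simp only [hfib]
      have hc : Nat.card {x : W' // hermInner σ x.1 x.1 = 0} =
          (Finset.univ.filter fun x : W' => hermInner σ x.1 x.1 = 0).card := by
        rw [Nat.card_eq_fintype_card, Fintype.card_subtype]
      have hc2 := Finset.card_filter_add_card_filter_not (s := (Finset.univ : Finset W'))
        (fun x : W' => hermInner σ x.1 x.1 = 0)
      rw [Finset.sum_ite, Finset.sum_const, Finset.sum_const, Nat.card_eq_fintype_card (α := W'),
        ← Finset.card_univ, ← hc2, hc]
      push_cast
      simp only [nsmul_eq_mul]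
      push_cast
      ring
    rw [card_sub hK, hd'] at hZ
    push_cast at hZ
    rw [hZ]
    linear_combination (-(q : ℚ)) * ih'

variable {σ} in
lemma selfOrth_insert (hs : ∀ x, σ (σ x) = x) (C : Submodule K (Fin n → K)) (v : Fin n → K) :
    (Submodule.span K {v} ⊔ C) ≤ hermDual σ (Submodule.span K {v} ⊔ C) ↔
      C ≤ hermDual σ C ∧ v ∈ hermDual σ C ∧ hermInner σ v v = 0 := by
  constructor
  · intro h
    have hv : v ∈ Submodule.span K {v} ⊔ C :=
      Submodule.mem_sup_left (Submodule.mem_span_singleton_self v)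
    exact ⟨fun x hx y hy => h (Submodule.mem_sup_right hx) y (Submodule.mem_sup_right hy),
      fun y hy => h hv y (Submodule.mem_sup_right hy), h hv v hv⟩
  · rintro ⟨h1, h2, h3⟩ x hx y hy
    obtain ⟨x1, hx1, x2, hx2, rfl⟩ := Submodule.mem_sup.1 hx
    obtain ⟨y1, hy1, y2, hy2, rfl⟩ := Submodule.mem_sup.1 hy
    obtain ⟨c, rfl⟩ := Submodule.mem_span_singleton.1 hx1
    obtain ⟨d, rfl⟩ := Submodule.mem_span_singleton.1 hy1
    rw [hI_add_left, hI_add_right, hI_add_right, hI_smul_left, hI_smul_left, hI_smul_right,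
      hI_smul_right, h3, h2 y2 hy2, h1 hx2 y2 hy2, hI_symm_zero hs (h2 x2 hx2)]
    simp

/-- independent tuples spanning a self-orthogonal code -/
abbrev LTup (n k : ℕ) : Type _ := {s : Fin k → Fin n → K // LinearIndependent K s ∧
  Submodule.span K (Set.range s) ≤ hermDual σ (Submodule.span K (Set.range s))}

lemma cons_iff (hs : ∀ x, σ (σ x) = x) {k : ℕ} (v : Fin n → K) (s : Fin k → Fin n → K) :
    (LinearIndependent K (Fin.cons v s : Fin (k + 1) → Fin n → K) ∧
      Submodule.span K (Set.range (Fin.cons v s : Fin (k + 1) → Fin n → K)) ≤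
      hermDual σ (Submodule.span K (Set.range (Fin.cons v s : Fin (k + 1) → Fin n → K)))) ↔
    (LinearIndependent K s ∧
      Submodule.span K (Set.range s) ≤ hermDual σ (Submodule.span K (Set.range s))) ∧
    (v ∈ hermDual σ (Submodule.span K (Set.range s)) ∧ hermInner σ v v = 0 ∧
      v ∉ Submodule.span K (Set.range s)) := by
  rw [linearIndependent_finCons, Fin.range_cons, Submodule.span_insert, selfOrth_insert hs]
  tauto

def LTupEquiv (hs : ∀ x, σ (σ x) = x) (k : ℕ) : LTup σ n (k + 1) ≃
    Σ s : LTup σ n k, {v : Fin n → K // v ∈ hermDual σ (Submodule.span K (Set.range s.1)) ∧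
      hermInner σ v v = 0 ∧ v ∉ Submodule.span K (Set.range s.1)} where
  toFun t := ⟨⟨Fin.tail t.1, ((cons_iff σ hs (t.1 0) (Fin.tail t.1)).1
      (by rw [Fin.cons_self_tail]; exact t.2)).1⟩, ⟨t.1 0, ((cons_iff σ hs (t.1 0) (Fin.tail t.1)).1
      (by rw [Fin.cons_self_tail]; exact t.2)).2⟩⟩
  invFun p := ⟨Fin.cons p.2.1 p.1.1, (cons_iff σ hs _ _).2 ⟨p.1.2, p.2.2⟩⟩
  left_inv t := by simp
  right_inv p := rfl

lemma card_ext {q : ℕ} (hq : 1 < q) [Fintype K] (hK : Fintype.card K = q ^ 2)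
    (hσ : ∀ x : K, σ x = x ^ q) (k : ℕ) (C : Submodule K (Fin n → K))
    (hk : Module.finrank K C = k) (hC : C ≤ hermDual σ C) :
    (q : ℚ) * Nat.card {v : Fin n → K // v ∈ hermDual σ C ∧ hermInner σ v v = 0 ∧ v ∉ C} =
      q ^ (2 * (n - k)) + (-1) ^ n * q ^ n * ((q : ℚ) - 1) - q ^ (2 * k + 1) := by
  classical
  have hd := finrank_hermDual σ hK hσ C
  have h1 := card_iso σ hq hK hσ (n - k) (hermDual σ C) (by omega)
  rw [hermDual_hermDual σ hK hσ, inf_eq_right.2 hC, hk, Nat.sub_add_cancel (by omega)] at h1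
  have e : {x : hermDual σ C // hermInner σ x.1 x.1 = 0} ≃
      {v : Fin n → K // v ∈ hermDual σ C ∧ hermInner σ v v = 0 ∧ v ∉ C} ⊕ C := by
    refine (Equiv.sumCompl fun x : {x : hermDual σ C // hermInner σ x.1 x.1 = 0} =>
      x.1.1 ∈ C).symm.trans ((Equiv.sumComm _ _).trans (Equiv.sumCongr ?_ ?_))
    · exact ⟨fun x => ⟨x.1.1.1, x.1.1.2, x.1.2, x.2⟩,
        fun x => ⟨⟨⟨x.1, x.2.1⟩, x.2.2.1⟩, x.2.2.2⟩, fun _ => rfl, fun _ => rfl⟩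
    · exact ⟨fun x => ⟨x.1.1.1, x.2⟩, fun x => ⟨⟨⟨x.1, hC x.2⟩, hC x.2 x.1 x.2⟩, x.2⟩,
        fun _ => rfl, fun _ => rfl⟩
  rw [Nat.card_congr e, Nat.card_sum, card_sub hK, hk] at h1
  push_cast at h1
  rw [← h1]
  ring

lemma card_LTup_succ {q : ℕ} (hq : 1 < q) [Fintype K] (hK : Fintype.card K = q ^ 2)
    (hσ : ∀ x : K, σ x = x ^ q) (k : ℕ) :
    (q : ℚ) * Nat.card (LTup σ n (k + 1)) = Nat.card (LTup σ n k) *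
      (q ^ (2 * (n - k)) + (-1) ^ n * q ^ n * ((q : ℚ) - 1) - q ^ (2 * k + 1)) := by
  classical
  have hs := sigma_sigma σ hK hσ
  have : Fintype (LTup σ n k) := Fintype.ofFinite _
  rw [Nat.card_congr (LTupEquiv σ hs k), Nat.card_sigma]
  push_cast
  rw [Finset.mul_sum, Finset.sum_congr rfl fun (s : LTup σ n k) _ => card_ext σ hq hK hσ k
    (Submodule.span K (Set.range s.1)) (by rw [finrank_span_eq_card s.2.1]; simp) s.2.2]
  rw [Finset.sum_const, nsmul_eq_mul, Finset.card_univ, Nat.card_eq_fintype_card]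

lemma card_LTup_codes {q : ℕ} [Fintype K] (hK : Fintype.card K = q ^ 2) (k : ℕ) :
    Nat.card (LTup σ n k) = Nat.card {C : Submodule K (Fin n → K) //
        Module.finrank K C = k ∧ C ≤ hermDual σ C} *
      ∏ i : Fin k, ((q ^ 2) ^ k - (q ^ 2) ^ i.val) := by
  classical
  have : Fintype {C : Submodule K (Fin n → K) //
        Module.finrank K C = k ∧ C ≤ hermDual σ C} := Fintype.ofFinite _
  have e : (Σ C : {C : Submodule K (Fin n → K) //
        Module.finrank K C = k ∧ C ≤ hermDual σ C},
        {s : Fin k → C.1 // LinearIndependent K s}) ≃ LTup σ n k := by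
    have key : ∀ (C : {C : Submodule K (Fin n → K) //
        Module.finrank K C = k ∧ C ≤ hermDual σ C}) (s : {s : Fin k → C.1 // LinearIndependent K s}),
        LinearIndependent K (fun i => (s.1 i : Fin n → K)) ∧
        Submodule.span K (Set.range (fun i => (s.1 i : Fin n → K))) = C.1 := by
      intro C s
      have hl : LinearIndependent K (fun i => (s.1 i : Fin n → K)) :=
        s.2.map' C.1.subtype (Submodule.ker_subtype _)
      refine ⟨hl, ?_⟩
      apply Submodule.eq_of_le_of_finrank_eq
      · rw [Submodule.span_le]
        rintro _ ⟨i, rfl⟩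
        exact (s.1 i).2
      · rw [finrank_span_eq_card hl, C.2.1]; simp
    refine Equiv.ofBijective (fun p => ⟨fun i => (p.2.1 i : Fin n → K), (key p.1 p.2).1, by
      rw [(key p.1 p.2).2]; exact p.1.2.2⟩) ⟨?_, ?_⟩
    · rintro ⟨C, s⟩ ⟨D, t⟩ h
      have h' := congrArg Subtype.val h
      simp only at h'
      have hCD : C = D := by
        apply Subtype.ext
        rw [← (key C s).2, ← (key D t).2, h']
      subst hCD
      have : s = t := by
        apply Subtype.ext
        funext i
        exact Subtype.ext (congrFun h' i)
      rw [this]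
    · rintro ⟨s, hl, hs⟩
      refine ⟨⟨⟨Submodule.span K (Set.range s), by rw [finrank_span_eq_card hl]; simp, hs⟩,
        ⟨fun i => ⟨s i, Submodule.subset_span ⟨i, rfl⟩⟩, ?_⟩⟩, rfl⟩
      exact LinearIndependent.of_comp (Submodule.span K (Set.range s)).subtype hl
  rw [← Nat.card_congr e, Nat.card_sigma]
  rw [Finset.sum_congr rfl fun C _ => (card_linearIndependent (K := K) (V := C.1) (k := k)
    C.2.1.ge).trans (by rw [C.2.1, hK])]
  rw [Finset.sum_const, smul_eq_mul, Finset.card_univ, Nat.card_eq_fintype_card]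

lemma card_LTup {q : ℕ} (hq : 1 < q) [Fintype K] (hK : Fintype.card K = q ^ 2)
    (hσ : ∀ x : K, σ x = x ^ q) (k : ℕ) (hkn : 2 * k ≤ n) :
    (Nat.card (LTup σ n k) : ℚ) = (∏ i ∈ Finset.Icc 1 k,
      ((q : ℚ) ^ (n - 2 * i + 1) * ((q : ℚ) ^ (n - 2 * i + 2) + (-1) ^ n * ((q : ℚ) - 1)) - 1)) *
      ∏ i ∈ Finset.range k, (q : ℚ) ^ (2 * i) := by
  have hq0 : (q : ℚ) ≠ 0 := by positivity
  induction k with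
  | zero =>
    have : Nat.card (LTup σ n 0) = 1 := by
      rw [Nat.card_eq_one_iff_unique]
      refine ⟨⟨fun a b => Subtype.ext (Subsingleton.elim _ _)⟩,
        ⟨⟨Fin.elim0, linearIndependent_empty_type, ?_⟩⟩⟩
      simp
    simp [this]
  | succ k ih =>
    apply mul_left_cancel₀ hq0
    rw [card_LTup_succ σ hq hK hσ, ih (by omega), Finset.prod_Icc_succ_top (by omega),
      Finset.prod_range_succ]
    obtain ⟨m, rfl⟩ : ∃ m, n = 2 * (k + 1) + m := ⟨n - 2 * (k + 1), by omega⟩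
    have h1 : 2 * (k + 1) + m - k = k + 2 + m := by omega
    have h2 : 2 * (k + 1) + m - 2 * (k + 1) = m := by omega
    rw [h1, h2]
    generalize (∏ i ∈ Finset.Icc 1 k, _ : ℚ) = A
    generalize (∏ i ∈ Finset.range k, _ : ℚ) = B
    ring

lemma prod_denom (Q : ℚ) (k : ℕ) :
    ∏ i ∈ Finset.range k, (Q ^ k - Q ^ i) =
      (∏ i ∈ Finset.range k, Q ^ i) * ∏ i ∈ Finset.Icc 1 k, (Q ^ i - 1) := by
  have : ∏ i ∈ Finset.Icc 1 k, (Q ^ i - 1) = ∏ i ∈ Finset.range k, (Q ^ (k - i) - 1) := by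
    rw [← Finset.prod_range_reflect, ← Finset.Ico_add_one_right_eq_Icc,
      Finset.prod_Ico_eq_prod_range]
    refine Finset.prod_congr (by simp) fun i hi => ?_
    have := Finset.mem_range.1 hi
    congr 2; omega
  rw [this, ← Finset.prod_mul_distrib]
  refine Finset.prod_congr rfl fun i hi => ?_
  have := Finset.mem_range.1 hi
  rw [mul_sub, ← pow_add, Nat.add_sub_cancel' this.le, mul_one]

end aux

/-- The number of Hermitian self-orthogonal `[n,k]_{q²}` codes equals
`∏_{i=1}^{k} (q^{n-2i+1}(q^{n-2i+2} + (-1)^n (q-1)) - 1) / (q^{2i} - 1)`. -/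
theorem card_hermitian_selfOrthogonal
    (q : ℕ) (hq : IsPrimePow q)
    {K : Type*} [Field K] [Fintype K] (hK : Fintype.card K = q ^ 2)
    (σ : K →+* K) (hσ : ∀ x : K, σ x = x ^ q)
    (n k : ℕ) (hn : 0 < n) (hk : 0 < k) (hkn : 2 * k ≤ n) :
    (Nat.card {C : Submodule K (Fin n → K) //
        Module.finrank K C = k ∧ C ≤ hermDual σ C} : ℚ) =
      ∏ i ∈ Finset.Icc 1 k,
        ((q : ℚ) ^ (n - 2 * i + 1) * ((q : ℚ) ^ (n - 2 * i + 2) + (-1) ^ n * ((q : ℚ) - 1)) - 1) /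
          ((q : ℚ) ^ (2 * i) - 1) := by
  have hq1 : 1 < q := hq.one_lt
  have h1 := card_LTup σ hq1 hK hσ k hkn
  rw [card_LTup_codes σ hK k, Finset.prod_range (fun i => ((q ^ 2) ^ k - (q ^ 2) ^ i))|>.symm] at h1
  push_cast at h1
  have h2 : ((∏ i ∈ Finset.range k, ((q ^ 2) ^ k - (q ^ 2) ^ i) : ℕ) : ℚ) =
      (∏ i ∈ Finset.range k, (q : ℚ) ^ (2 * i)) *
        ∏ i ∈ Finset.Icc 1 k, ((q : ℚ) ^ (2 * i) - 1) := by
    simp only [pow_mul]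
    rw [← prod_denom, Nat.cast_prod]
    refine Finset.prod_congr rfl fun i hi => ?_
    rw [Nat.cast_sub (Nat.pow_le_pow_right (by positivity) (Finset.mem_range.1 hi).le)]
    push_cast
    rfl
  rw [← Nat.cast_prod, h2] at h1
  have hA : (∏ i ∈ Finset.range k, (q : ℚ) ^ (2 * i)) ≠ 0 :=
    Finset.prod_ne_zero_iff.2 fun i _ => by positivity
  have hB : (∏ i ∈ Finset.Icc 1 k, ((q : ℚ) ^ (2 * i) - 1)) ≠ 0 := by
    refine Finset.prod_ne_zero_iff.2 fun i hi => ?_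
    have hi1 := (Finset.mem_Icc.1 hi).1
    have : (1 : ℚ) < (q : ℚ) ^ (2 * i) := one_lt_pow₀ (by exact_mod_cast hq1) (by omega)
    exact (sub_pos.2 this).ne'
  rw [Finset.prod_div_distrib, eq_div_iff hB]
  apply mul_right_cancel₀ hA
  linear_combination h1
end
end
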